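/- Let Γ be a metric graph with a fixed self-loop-free model and let D ∈ |D_0| be a generic divisor in a complete linear system. Then dim Δ_D ≥ r(D), where Δ_D is the maximal cell of |D_0| whose relative interior contains D and r(D) is the rank of D. Consequently, for every divisor D ∈ |D_0|, the local dimension dim_D |D_0| is at least r(D_0). -/

import Mathlib

open scoped ENNReal
open Set Function

namespace TropGraph

variable {G : Type*} [MetricSpace G]

/-! ### Metric graphs: length spaces with star-shaped neighbourhoods -/

/-- The length of a path, via the extended variation of its extension to `ℝ`. -/
noncomputable def pathLength {x y : G} (g : Path x y) : ℝ≥0∞ :=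
  eVariationOn (fun t : ℝ => g.extend t) (Set.Icc 0 1)

/-- The star with `v` branches of radius `ε`: a disjoint union of `v` copies of `[0, ε)`
with all the zeroes identified. -/
def starSetoid (v : ℕ) (ε : ℝ) : Setoid (Fin v × Set.Ico (0:ℝ) ε) where
  r a b := a = b ∨ ((a.2 : ℝ) = 0 ∧ (b.2 : ℝ) = 0)
  iseqv :=
    { refl := fun _ => Or.inl rfl
      symm := fun h => h.imp Eq.symm And.symm
      trans := fun h₁ h₂ => by
        rcases h₁ with rfl | h₁
        · exact h₂
        · rcases h₂ with rfl | h₂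
          · exact Or.inr h₁
          · exact Or.inr ⟨h₁.1, h₂.2⟩ }

/-- The glued star-shaped space `⊔_{i=1}^v [0, ε) / ∼`. -/
def StarGlue (v : ℕ) (ε : ℝ) : Type :=
  Quotient (starSetoid v ε)

instance (v : ℕ) (ε : ℝ) : TopologicalSpace (StarGlue v ε) := by
  unfold StarGlue; infer_instance

/-- `U` is a star-shaped neighbourhood of `x` of valence `v`. -/
def IsStarNbhdOf (x : G) (v : ℕ) (U : Set G) : Prop :=
  ∃ (ε : ℝ) (hε : 0 < ε) (φ : U ≃ₜ StarGlue v ε) (hx : x ∈ U),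
    ∀ i : Fin v, φ ⟨x, hx⟩ = Quotient.mk (starSetoid v ε) (i, ⟨0, le_rfl, hε⟩)

/-- A metric graph: a compact length space in which every point has a star-shaped
neighbourhood. -/
def IsMetricGraph (X : Type*) [MetricSpace X] : Prop :=
  CompactSpace X ∧
  (∀ x y : X, edist x y = ⨅ g : Path x y, pathLength g) ∧
  ∀ x : X, ∃ (v : ℕ) (U : Set X), U ∈ nhds x ∧ IsStarNbhdOf x v U

/-- `x` has valence `v`. -/
def HasValence (x : G) (v : ℕ) : Prop :=
  ∃ U ∈ nhds x, IsStarNbhdOf x v U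

/-! ### Rational functions, tangent directions, orders and divisors -/

/-- `g` is a unit speed (isometric) path of length `ε` starting at `x`. -/
def IsUnitSpeedFrom (x : G) (ε : ℝ) (g : ℝ → G) : Prop :=
  g 0 = x ∧ ∀ s ∈ Set.Ico (0:ℝ) ε, ∀ t ∈ Set.Ico (0:ℝ) ε, dist (g s) (g t) = |s - t|

/-- `f` has (integer) slope `s` along the path `g` near its starting point. -/
def HasSlopeAlong (f : G → ℝ) (g : ℝ → G) (s : ℤ) : Prop :=
  ∃ δ > (0:ℝ), ∀ t ∈ Set.Ico (0:ℝ) δ, f (g t) = f (g 0) + s * t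

/-- A rational function: continuous, and linear with integer slope along every direction
near every point.  (On a compact metric graph this coincides with being continuous
piecewise linear with integer slopes.) -/
def IsRational (f : G → ℝ) : Prop :=
  Continuous f ∧ ∀ (x : G) (ε : ℝ) (g : ℝ → G), 0 < ε → IsUnitSpeedFrom x ε g →
    ∃ s : ℤ, HasSlopeAlong f g s

/-- Unit speed paths emanating from `x`. -/
def UnitPath (x : G) : Type _ :=
  {g : ℝ → G // ∃ ε > (0:ℝ), IsUnitSpeedFrom x ε g}

/-- Two unit speed paths are equivalent when they agree near `0`. -/
def germSetoid (x : G) : Setoid (UnitPath x) where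
  r g₁ g₂ := ∃ δ > (0:ℝ), ∀ t ∈ Set.Ico (0:ℝ) δ, g₁.1 t = g₂.1 t
  iseqv := by
    constructor
    · intro g
      obtain ⟨ε, hε, _⟩ := g.2
      exact ⟨ε, hε, fun t _ => rfl⟩
    · rintro g₁ g₂ ⟨δ, hδ, h⟩
      exact ⟨δ, hδ, fun t ht => (h t ht).symm⟩
    · rintro g₁ g₂ g₃ ⟨δ₁, hδ₁, h₁⟩ ⟨δ₂, hδ₂, h₂⟩
      refine ⟨min δ₁ δ₂, lt_min hδ₁ hδ₂, fun t ht => ?_⟩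
      have ht' := Set.mem_Ico.mp ht
      rw [h₁ t (Set.mem_Ico.mpr ⟨ht'.1, lt_of_lt_of_le ht'.2 (min_le_left _ _)⟩),
        h₂ t (Set.mem_Ico.mpr ⟨ht'.1, lt_of_lt_of_le ht'.2 (min_le_right _ _)⟩)]

/-- The set of (unit) tangent directions at `x`: germs of unit speed paths from `x`. -/
def TangentDir (x : G) : Type _ :=
  Quotient (germSetoid x)

open scoped Classical in
/-- The outgoing slope of `f` along a tangent direction. -/
noncomputable def tangentSlope (f : G → ℝ) {x : G} (ζ : TangentDir x) : ℤ :=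
  if h : ∃ s : ℤ, HasSlopeAlong f (Quotient.out ζ).1 s then h.choose else 0

/-- The order of `f` at `x`: the sum of the outgoing slopes of `f` at `x`. -/
noncomputable def ordAt (f : G → ℝ) (x : G) : ℤ :=
  ∑ᶠ ζ : TangentDir x, tangentSlope f ζ

/-- Divisors are represented as finitely supported functions `G → ℤ`. -/
def FinSupp (D : G → ℤ) : Prop :=
  (Function.support D).Finite

/-- A divisor is effective when all its coefficients are nonnegative. -/
def Effective (D : G → ℤ) : Prop :=
  ∀ x, 0 ≤ D x

/-- The degree of a divisor. -/
noncomputable def deg (D : G → ℤ) : ℤ :=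
  ∑ᶠ x, D x

/-- The degree of the restriction of a divisor to a subset. -/
noncomputable def degOn (S : Set G) (D : G → ℤ) : ℤ :=
  ∑ᶠ x ∈ S, D x

/-- Linear equivalence of divisors: the difference is the divisor of a rational function. -/
def LinEquiv (D D' : G → ℤ) : Prop :=
  ∃ f : G → ℝ, IsRational f ∧ ∀ x, D' x = D x + ordAt f x

/-- `R(D)`: rational functions `f` with `D + div f ≥ 0`. -/
def RD (D : G → ℤ) : Set (G → ℝ) :=
  {f | IsRational f ∧ ∀ x, 0 ≤ D x + ordAt f x}

/-- The complete linear system `|D₀|` of effective divisors linearly equivalent to `D₀`. -/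
def LinSys (D₀ : G → ℤ) : Set (G → ℤ) :=
  {D | FinSupp D ∧ Effective D ∧ LinEquiv D₀ D}

/-- The oscillation `max f - min f` of a function. -/
noncomputable def osc (f : G → ℝ) : ℝ :=
  sSup (Set.range f) - sInf (Set.range f)

/-- The distance `d_∞` on a complete linear system. -/
noncomputable def linDist (D₁ D₂ : G → ℤ) : ℝ :=
  sInf {r : ℝ | ∃ f : G → ℝ, IsRational f ∧ (∀ x, D₂ x = D₁ x + ordAt f x) ∧ r = osc f}

/-- `f` is constant on `S`. -/
def ConstOn (f : G → ℝ) (S : Set G) : Prop :=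
  ∀ x ∈ S, ∀ y ∈ S, f x = f y

/-! ### Subgraphs, arcs, components, firing -/

/-- An open arc: the isometric image of a nonempty open interval. -/
def IsOpenArc (S : Set G) : Prop :=
  ∃ (a b : ℝ) (g : ℝ → G), a < b ∧
    (∀ s ∈ Set.Ioo a b, ∀ t ∈ Set.Ioo a b, dist (g s) (g t) = |s - t|) ∧
    S = g '' Set.Ioo a b

/-- The set of connected components of a subset. -/
def compsOf (S : Set G) : Set (Set G) :=
  {C | ∃ x ∈ S, C = connectedComponentIn S x}

/-- The outgoing degree of `x` with respect to a closed subgraph `Z`: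
the number of tangent directions at `x` leaving `Z`. -/
noncomputable def degOut (Z : Set G) (x : G) : ℕ :=
  Nat.card {ζ : TangentDir x //
    ∃ δ > (0:ℝ), ∀ t ∈ Set.Ioo (0:ℝ) δ, (Quotient.out ζ).1 t ∉ interior Z}

/-- A closed subgraph `Z` can fire with respect to `D` when `D(x) ≥ deg^out_Z(x)` for
all `x` on the boundary of `Z`. -/
def CanFire (D : G → ℤ) (Z : Set G) : Prop :=
  Z.Nonempty ∧ IsClosed Z ∧ (compsOf Z).Finite ∧
  ∀ x ∈ frontier Z, (degOut Z x : ℤ) ≤ D x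

/-- A `v`-reduced divisor. -/
def IsReduced (v : G) (D : G → ℤ) : Prop :=
  (∀ x, x ≠ v → 0 ≤ D x) ∧ ∀ Z : Set G, v ∉ Z → ¬CanFire D Z

/-- `D` is `V`-unsaturated: no closed subgraph whose boundary meets `V` can fire. -/
def Unsaturated (V : Set G) (D : G → ℤ) : Prop :=
  ¬∃ Z : Set G, (frontier Z ∩ V).Nonempty ∧ CanFire D Z

/-- A local maximum of `f`: a closed connected set on which `f` is constant, with a
neighbourhood on which `f` is strictly smaller outside of it. -/
def IsLocalMaxSet (f : G → ℝ) (C : Set G) : Prop :=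
  IsClosed C ∧ IsConnected C ∧ ConstOn f C ∧
  ∃ U, IsOpen U ∧ C ⊆ U ∧ ∀ x ∈ U \ C, ∀ y ∈ C, f x < f y

/-! ### Models and genus -/

/-- A model of the metric graph: a finite set of vertices whose complement is a finite
disjoint union of open arcs. -/
def IsGraphModel (V : Set G) : Prop :=
  V.Finite ∧ (compsOf Vᶜ).Finite ∧ ∀ C ∈ compsOf Vᶜ, IsOpenArc C

/-- A model has no self-loops: the closure of each open edge contains two distinct
endpoints. -/
def LoopFree (V : Set G) : Prop :=
  ∀ C ∈ compsOf Vᶜ, (closure C \ C).ncard = 2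

/-- A model of an open subgraph `U`, together with valences of its vertices inside `U`. -/
def IsModelIn (U V : Set G) (val : G → ℕ) : Prop :=
  V ⊆ U ∧ V.Finite ∧
  (∀ x ∈ V, ∃ W ∈ nhds x, W ⊆ U ∧ IsStarNbhdOf x (val x) W) ∧
  (compsOf (U \ V)).Finite ∧ (∀ C ∈ compsOf (U \ V), IsOpenArc C) ∧
  (compsOf U).Finite

/-- The genus (first Betti number) of an open subgraph `U`, i.e. of its completion:
computed from any model as `Σ val(x) - #edges - #vertices + #components`. -/
def HasGenusOpen (U : Set G) (g : ℤ) : Prop :=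
  ∃ (V : Set G) (val : G → ℕ), IsModelIn U V val ∧
    g = (∑ᶠ x ∈ V, (val x : ℤ)) - ((compsOf (U \ V)).ncard : ℤ)
        - (V.ncard : ℤ) + ((compsOf U).ncard : ℤ)

/-! ### Chip firing moves -/

/-- The open `ε`-neighbourhood of `Z`. -/
def ZNbhd (Z : Set G) (ε : ℝ) : Set G :=
  {x | Metric.infDist x Z < ε}

/-- The chip firing function `CF(Z, ε)`. -/
noncomputable def CF (Z : Set G) (ε : ℝ) : G → ℝ :=
  fun x => -min (Metric.infDist x Z) ε

/-- The data of a chip firing move: a closed subgraph with finitely many components such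
that `Z_ε \ Z` is a disjoint union of open intervals. -/
def ChipData (Z : Set G) (ε : ℝ) : Prop :=
  IsClosed Z ∧ Z.Nonempty ∧ (compsOf Z).Finite ∧
  ∀ C ∈ compsOf (ZNbhd Z ε \ Z), IsOpenArc C

/-- `h` is a chip firing move. -/
def IsCFMove (h : G → ℝ) : Prop :=
  ∃ (Z : Set G) (ε : ℝ), 0 < ε ∧ ChipData Z ε ∧ h = CF Z ε

/-- `f` is linear (with some real slope) on the open arc `C`. -/
def LinearOnArc (f : G → ℝ) (C : Set G) : Prop :=
  ∃ (a b : ℝ) (g : ℝ → G) (s c : ℝ), a < b ∧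
    (∀ u ∈ Set.Ioo a b, ∀ t ∈ Set.Ioo a b, dist (g u) (g t) = |u - t|) ∧
    C = g '' Set.Ioo a b ∧ ∀ t ∈ Set.Ioo a b, f (g t) = s * t + c

/-- A weighted chip firing move. -/
def IsWeightedCF (f : G → ℝ) : Prop :=
  IsRational f ∧ (¬∀ x y : G, f x = f y) ∧
  ∃ Z₁ Z₂ : Set G, IsClosed Z₁ ∧ IsClosed Z₂ ∧ Z₁.Nonempty ∧ Z₂.Nonempty ∧
    Disjoint Z₁ Z₂ ∧ Z₁ ≠ Set.univ ∧ Z₂ ≠ Set.univ ∧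
    (∀ C ∈ compsOf (Z₁ ∪ Z₂)ᶜ, IsOpenArc C) ∧
    ConstOn f Z₁ ∧ ConstOn f Z₂ ∧
    ∀ C ∈ compsOf (Z₁ ∪ Z₂)ᶜ, LinearOnArc f C

/-! ### Cells of the complete linear system -/

/-- The part of the support of a divisor lying in the interiors of the edges. -/
def edgeSupp (V : Set G) (D : G → ℤ) : Set G :=
  {x | x ∉ V ∧ D x ≠ 0}

/-- The dimension of the cell of `|D₀|` containing `D` in its relative interior:
the number of connected components of `Γ ∖ supp D_E`, minus one. -/
noncomputable def cellDim (V : Set G) (D : G → ℤ) : ℤ :=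
  ((compsOf (edgeSupp V D)ᶜ).ncard : ℤ) - 1

/-- Two divisors of `|D₀|` have the same combinatorial type with respect to the model `V`
(they lie in the relative interior of the same cell): equal multiplicities on the
vertices, chip configurations on the edges related by a homeomorphism fixing the
vertices and each edge, and equal slopes at all tangent directions at the vertices. -/
def SameType (V : Set G) (D₀ D₁ D₂ : G → ℤ) : Prop :=
  (∀ v ∈ V, D₁ v = D₂ v) ∧
  (∃ h : G ≃ₜ G, (∀ v ∈ V, h v = v) ∧ (∀ x ∉ V, h x ∈ connectedComponentIn Vᶜ x) ∧
    ∀ x, D₂ (h x) = D₁ x) ∧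
  (∃ f₁ f₂ : G → ℝ, IsRational f₁ ∧ IsRational f₂ ∧
    (∀ x, D₁ x = D₀ x + ordAt f₁ x) ∧ (∀ x, D₂ x = D₀ x + ordAt f₂ x) ∧
    ∀ v ∈ V, ∀ ζ : TangentDir v, tangentSlope f₁ ζ = tangentSlope f₂ ζ)

/-- `D'` lies in the closed cell `Δ_D` of `|D₀|`. -/
def InClosedCell (V : Set G) (D₀ D D' : G → ℤ) : Prop :=
  ∀ ε > (0:ℝ), ∃ D'' : G → ℤ, SameType V D₀ D D'' ∧ linDist D' D'' < ε

/-- `D` is generic in `|D₀|`: it lies in the relative interior of an inclusion-wise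
maximal cell, i.e. all sufficiently nearby divisors of `|D₀|` lie in the closed cell
of `D`. -/
def Generic (V : Set G) (D₀ D : G → ℤ) : Prop :=
  D ∈ LinSys D₀ ∧ ∃ ε > (0:ℝ), ∀ D' ∈ LinSys D₀, linDist D D' < ε → InClosedCell V D₀ D D'

/-- The rank of `D` is at least `d`: for every effective divisor `E` of degree `d`,
`|D - E|` is nonempty. -/
def rankGe (D : G → ℤ) (d : ℕ) : Prop :=
  ∀ E : G → ℤ, FinSupp E → Effective E → deg E = (d : ℤ) →
    ∃ D' : G → ℤ, FinSupp D' ∧ Effective D' ∧ LinEquiv (fun x => D x - E x) D'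

/-! ### Cycles, the canonical divisor and realizability -/

/-- A simple cycle: a subset homeomorphic to a circle. -/
def IsCycleSet (C : Set G) : Prop :=
  Nonempty (C ≃ₜ AddCircle (1 : ℝ))

/-- The canonical divisor `K + div f` for a vertex valence function `val`. -/
noncomputable def canDiv (val : G → ℕ) (f : G → ℝ) : G → ℤ :=
  fun x => (val x : ℤ) - 2 + ordAt f x

/-- The enhanced-level-graph invariant `k(ζ) = -s_ζ(f) - 1` of a tangent direction. -/
noncomputable def kVal (f : G → ℝ) {v : G} (ζ : TangentDir v) : ℤ :=
  -(tangentSlope f ζ) - 1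

/-- `v` is an inconvenient vertex of the enhanced level graph `Γ⁺(f)` (all vertex
weights `h ≡ 0`): no `k`-value equals `-1`, and some `k`-value (of a half-edge, or of
one of the `D(v)` attached legs, which carry `k = 1`) exceeds
`Σ_{k_j < 0} (-k_j) - #{k_j < 0} - 1`.  (Legs have `k = 1 > 0` and so never contribute
to the sums, and their `k`-value is `≠ -1`.) -/
def Inconvenient (val : G → ℕ) (f : G → ℝ) (v : G) : Prop :=
  (∀ ζ : TangentDir v, kVal f ζ ≠ -1) ∧
  ∃ k₀ : ℤ, ((∃ ζ : TangentDir v, kVal f ζ = k₀) ∨ (0 < canDiv val f v ∧ k₀ = 1)) ∧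
    (∑ᶠ ζ ∈ {ζ : TangentDir v | kVal f ζ < 0}, (-kVal f ζ))
      - (({ζ : TangentDir v | kVal f ζ < 0}).ncard : ℤ) - 1 < k₀

/-- The realizability criterion of Möller–Ulirsch–Werner for the effective canonical
divisor `K + div f`: every inconvenient vertex, and every open arc on which `f` is
constant, away from the bends of `f` and from higher-valence points, is contained in a
simple cycle lying above it. -/
def RealizableFn (val : G → ℕ) (f : G → ℝ) : Prop :=
  (∀ v, Inconvenient val f v →
    ∃ Z : Set G, IsCycleSet Z ∧ v ∈ Z ∧ ∀ z ∈ Z, f v ≤ f z) ∧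
  (∀ A : Set G, IsOpenArc A → ConstOn f A → (∀ x ∈ A, ordAt f x = 0 ∧ val x = 2) →
    ∃ Z : Set G, IsCycleSet Z ∧ A ⊆ Z ∧ ∀ z ∈ Z, ∀ a ∈ A, f a ≤ f z)

/-- The realizability locus inside the canonical linear system. -/
def RealSet (val : G → ℕ) : Set (G → ℤ) :=
  {D | ∃ f : G → ℝ, IsRational f ∧ (∀ x, D x = (val x : ℤ) - 2 + ordAt f x) ∧
    RealizableFn val f}

/-! ### Tropical linear series -/

/-- The cone `R(𝔡, D)` of rational functions `f` with `D + div f ∈ 𝔡`. -/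
def coneOf (D : G → ℤ) (𝔡 : Set (G → ℤ)) : Set (G → ℝ) :=
  {f | IsRational f ∧ (fun x => D x + ordAt f x) ∈ 𝔡}

/-- A tropical linear series: a tropically convex subset of a complete linear system,
i.e. one whose cone of rational functions is a tropical submodule. -/
def TropLinearSeries (D₀ : G → ℤ) (𝔡 : Set (G → ℤ)) : Prop :=
  𝔡 ⊆ LinSys D₀ ∧
  (∀ f ∈ coneOf D₀ 𝔡, ∀ g ∈ coneOf D₀ 𝔡, (fun x => max (f x) (g x)) ∈ coneOf D₀ 𝔡) ∧
  (∀ c : ℝ, ∀ f ∈ coneOf D₀ 𝔡, (fun x => c + f x) ∈ coneOf D₀ 𝔡)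

/-- The rank of the tropical linear series `𝔡` is at least `d`:
`𝔡(-E)` is nonempty for every effective divisor `E` of degree `d`. -/
def lsRankGe (𝔡 : Set (G → ℤ)) (d : ℕ) : Prop :=
  ∀ E : G → ℤ, FinSupp E → Effective E → deg E = (d : ℤ) →
    ∃ D ∈ 𝔡, ∀ x, E x ≤ D x

/-- `D` splits in `𝔡`: some non-constant `f ∈ R(𝔡, D)`, with maximum locus `Z`, has a
boundary point `x ∈ ∂Z` with `D(x) + ord_x(f) > 0`. -/
def Splits (𝔡 : Set (G → ℤ)) (D : G → ℤ) : Prop :=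
  ∃ f ∈ coneOf D 𝔡, (¬∀ x y : G, f x = f y) ∧
    ∃ x ∈ frontier {y | ∀ z, f z ≤ f y}, 0 < D x + ordAt f x

/-- The pairing of a divisor with a test function. -/
noncomputable def pairing (D : G → ℤ) (φ : G → ℝ) : ℝ :=
  ∑ᶠ x, (D x : ℝ) * φ x

/-- The tangent space of `X` at `D` has dimension at least `r`: there are `r`
one-sided differentiable paths through `D` inside `X` whose derivatives (as linear
functionals on rational test functions) are linearly independent. -/
def TangentDimGe (X : Set (G → ℤ)) (D : G → ℤ) (r : ℕ) : Prop :=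
  ∃ (c : Fin r → ℝ → G → ℤ) (L : Fin r → (G → ℝ) → ℝ) (ε : ℝ), 0 < ε ∧
    (∀ i, c i 0 = D) ∧ (∀ i, ∀ t ∈ Set.Ico (0:ℝ) ε, c i t ∈ X) ∧
    (∀ i, ∀ φ : G → ℝ, IsRational φ →
      HasDerivWithinAt (fun t => pairing (c i t) φ) (L i φ) (Set.Ici 0) 0) ∧
    LinearIndependent ℝ L

set_option linter.unusedSectionVars false

/-! ### Edge charts of a model -/

/-- Isometric parametrizations of the closed edges of a model, with endpoints in `V`. -/
structure EdgeAtlas (V : Set G) where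
  finV : V.Finite
  finE : Finite (compsOf Vᶜ)
  len : compsOf Vᶜ → ℝ
  map : compsOf Vᶜ → ℝ → G
  len_pos : ∀ e, 0 < len e
  isom : ∀ e, ∀ s ∈ Icc 0 (len e), ∀ t ∈ Icc 0 (len e), dist (map e s) (map e t) = |s - t|
  range : ∀ e, map e '' Ioo 0 (len e) = e
  left : ∀ e, map e 0 ∈ V
  right : ∀ e, map e (len e) ∈ V

theorem closure_inter_subset_of_mem_compsOf {S C : Set G} (hC : C ∈ compsOf S) :
    closure C ∩ S ⊆ C := by
  obtain ⟨x, hx, rfl⟩ := hC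
  rintro y ⟨hy, hyS⟩
  have h1 : IsPreconnected (insert y (connectedComponentIn S x)) :=
    isPreconnected_connectedComponentIn.subset_closure (subset_insert _ _)
      (insert_subset hy subset_closure)
  exact h1.subset_connectedComponentIn (mem_insert_of_mem _ (mem_connectedComponentIn hx))
    (insert_subset hyS (connectedComponentIn_subset _ _)) (mem_insert _ _)

theorem subset_of_mem_compsOf {S C : Set G} (hC : C ∈ compsOf S) : C ⊆ S := by
  obtain ⟨x, hx, rfl⟩ := hC
  exact connectedComponentIn_subset _ _

theorem eq_of_mem_compsOf {S C C' : Set G} (hC : C ∈ compsOf S) (hC' : C' ∈ compsOf S) {y : G}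
    (h : y ∈ C) (h' : y ∈ C') : C = C' := by
  obtain ⟨x, hx, rfl⟩ := hC
  obtain ⟨x', hx', rfl⟩ := hC'
  rw [connectedComponentIn_eq h, connectedComponentIn_eq h']

theorem connectedComponentIn_mem_compsOf {S : Set G} {x : G} (hx : x ∈ S) :
    connectedComponentIn S x ∈ compsOf S := ⟨x, hx, rfl⟩

/-- An isometric open arc in a compact space has an initial endpoint. -/
theorem exists_arc_endpoint [CompactSpace G] {ℓ : ℝ} (hℓ : 0 < ℓ) {g : ℝ → G}
    (hg : ∀ s ∈ Ioo 0 ℓ, ∀ t ∈ Ioo 0 ℓ, dist (g s) (g t) = |s - t|) :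
    ∃ v ∈ closure (g '' Ioo 0 ℓ), ∀ t ∈ Ioo 0 ℓ, dist v (g t) = t := by
  let u : ℕ → ℝ := fun n => ℓ / (n + 2)
  have hu : ∀ n, u n ∈ Ioo 0 ℓ := fun n => by
    have : (0 : ℝ) ≤ n := n.cast_nonneg
    refine ⟨by positivity, ?_⟩
    rw [div_lt_iff₀ (by positivity)]
    nlinarith
  have hu0 : Filter.Tendsto u Filter.atTop (nhds 0) := by
    refine Filter.Tendsto.div_atTop tendsto_const_nhds ?_
    exact Filter.tendsto_atTop_add_const_right _ _ tendsto_natCast_atTop_atTop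
  obtain ⟨v, φ, hφ, hv⟩ := CompactSpace.tendsto_subseq (fun n => g (u n))
  refine ⟨v, mem_closure_of_tendsto hv (Filter.Eventually.of_forall fun n =>
    ⟨_, hu _, rfl⟩), fun t ht => ?_⟩
  have h1 : Filter.Tendsto (fun n => dist (g (u (φ n))) (g t)) Filter.atTop
      (nhds (dist v (g t))) := hv.dist tendsto_const_nhds
  have h2 : Filter.Tendsto (fun n => |u (φ n) - t|) Filter.atTop (nhds |0 - t|) :=
    ((hu0.comp hφ.tendsto_atTop).sub_const t).abs
  have h3 := tendsto_nhds_unique h1 (h2.congr fun n => (hg _ (hu _) _ ht).symm)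
  rw [h3, zero_sub, abs_neg, abs_of_pos ht.1]

theorem exists_edge_chart [CompactSpace G] {V C : Set G} (hC : C ∈ compsOf Vᶜ)
    (hA : IsOpenArc C) :
    ∃ (ℓ : ℝ) (g : ℝ → G), 0 < ℓ ∧
      (∀ s ∈ Icc 0 ℓ, ∀ t ∈ Icc 0 ℓ, dist (g s) (g t) = |s - t|) ∧
      g '' Ioo 0 ℓ = C ∧ g 0 ∈ V ∧ g ℓ ∈ V := by
  obtain ⟨a, b, k, hab, hk, rfl⟩ := hA
  set ℓ := b - a with hℓ
  have hℓ0 : 0 < ℓ := sub_pos.2 hab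
  set p : ℝ → G := fun s => k (a + s) with hp
  have hpI : p '' Ioo 0 ℓ = k '' Ioo a b := by
    ext y
    constructor
    · rintro ⟨s, hs, rfl⟩
      exact ⟨a + s, ⟨by linarith [hs.1], by linarith [hs.2]⟩, rfl⟩
    · rintro ⟨s, hs, rfl⟩
      exact ⟨s - a, ⟨by linarith [hs.1], by linarith [hs.2]⟩, by simp [hp]⟩
  have hpd : ∀ s ∈ Ioo 0 ℓ, ∀ t ∈ Ioo 0 ℓ, dist (p s) (p t) = |s - t| := by
    intro s hs t ht
    rw [hp, hk _ ⟨by linarith [hs.1], by linarith [hs.2]⟩ _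
      ⟨by linarith [ht.1], by linarith [ht.2]⟩]
    congr 1; ring
  obtain ⟨v, hvc, hv⟩ := exists_arc_endpoint hℓ0 hpd
  have hqd : ∀ s ∈ Ioo 0 ℓ, ∀ t ∈ Ioo 0 ℓ,
      dist ((fun s => p (ℓ - s)) s) ((fun s => p (ℓ - s)) t) = |s - t| := by
    intro s hs t ht
    simp only
    rw [hpd _ ⟨by linarith [hs.2], by linarith [hs.1]⟩ _
      ⟨by linarith [ht.2], by linarith [ht.1]⟩, abs_sub_comm s t]
    congr 1; ring
  have hqI : (fun s => p (ℓ - s)) '' Ioo 0 ℓ = p '' Ioo 0 ℓ := by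
    ext y
    constructor
    · rintro ⟨s, hs, rfl⟩
      exact ⟨ℓ - s, ⟨by linarith [hs.2], by linarith [hs.1]⟩, rfl⟩
    · rintro ⟨s, hs, rfl⟩
      exact ⟨ℓ - s, ⟨by linarith [hs.2], by linarith [hs.1]⟩, by simp⟩
  obtain ⟨w, hwc, hw⟩ := exists_arc_endpoint hℓ0 hqd
  rw [hqI] at hwc
  have hw' : ∀ t ∈ Ioo 0 ℓ, dist w (p t) = ℓ - t := by
    intro t ht
    have := hw (ℓ - t) ⟨by linarith [ht.2], by linarith [ht.1]⟩
    simpa using this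
  have hvw : dist v w = ℓ := by
    apply le_antisymm
    · have h1 := dist_triangle v (p (ℓ/2)) w
      rw [hv _ ⟨by linarith, by linarith⟩, dist_comm (p (ℓ/2)) w,
        hw' _ ⟨by linarith, by linarith⟩] at h1
      linarith
    · apply le_of_forall_pos_le_add
      intro ε hε
      set t := min (ε/2) (ℓ/2) with ht
      have ht0 : 0 < t := lt_min (by linarith) (by linarith)
      have ht1 : t ≤ ε/2 := min_le_left _ _
      have ht2 : t ≤ ℓ/2 := min_le_right _ _
      have h1 := dist_triangle w v (p t)
      rw [hv _ ⟨ht0, by linarith⟩, hw' _ ⟨ht0, by linarith⟩, dist_comm w v] at h1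
      linarith
  have hvV : v ∈ V := by
    by_contra h
    have hm : v ∈ p '' Ioo 0 ℓ := by
      rw [hpI]
      exact closure_inter_subset_of_mem_compsOf hC ⟨by rwa [← hpI], h⟩
    obtain ⟨t, ht, htv⟩ := hm
    have := hv t ht
    rw [htv, dist_self] at this
    linarith [ht.1]
  have hwV : w ∈ V := by
    by_contra h
    have hm : w ∈ p '' Ioo 0 ℓ := by
      rw [hpI]
      exact closure_inter_subset_of_mem_compsOf hC ⟨by rwa [← hpI], h⟩
    obtain ⟨t, ht, htv⟩ := hm
    have := hw' t ht
    rw [htv, dist_self] at this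
    linarith [ht.2]
  refine ⟨ℓ, fun s => if s ≤ 0 then v else if ℓ ≤ s then w else p s, hℓ0, ?_, ?_, ?_, ?_⟩
  · intro s hs t ht
    have cs : s = 0 ∨ s = ℓ ∨ s ∈ Ioo 0 ℓ := by
      rcases hs.1.eq_or_lt with h | h
      · exact Or.inl h.symm
      rcases hs.2.eq_or_lt with h' | h'
      · exact Or.inr (Or.inl h')
      · exact Or.inr (Or.inr ⟨h, h'⟩)
    have ct : t = 0 ∨ t = ℓ ∨ t ∈ Ioo 0 ℓ := by
      rcases ht.1.eq_or_lt with h | h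
      · exact Or.inl h.symm
      rcases ht.2.eq_or_lt with h' | h'
      · exact Or.inr (Or.inl h')
      · exact Or.inr (Or.inr ⟨h, h'⟩)
    rcases cs with rfl | rfl | cs <;> rcases ct with rfl | rfl | ct
    · simp
    · simp [hℓ0.not_ge, hvw, abs_of_pos hℓ0]
    · simp [ct.1.not_ge, ct.2.not_ge, hv t ct, abs_of_pos ct.1]
    · simp [hℓ0.not_ge, dist_comm w v, hvw, abs_of_pos hℓ0]
    · simp
    · simp [ct.1.not_ge, ct.2.not_ge, hw' t ct, hℓ0.not_ge]
      rw [abs_of_pos (by linarith [ct.2])]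
    · simp [cs.1.not_ge, cs.2.not_ge, dist_comm _ v, hv s cs, abs_of_pos cs.1]
    · simp [cs.1.not_ge, cs.2.not_ge, dist_comm _ w, hw' s cs, hℓ0.not_ge]
      rw [abs_of_neg (by linarith [cs.2])]; ring
    · simp [cs.1.not_ge, cs.2.not_ge, ct.1.not_ge, ct.2.not_ge, hpd s cs t ct]
  · rw [← hpI]
    apply image_congr
    intro s hs
    simp [hs.1.not_ge, hs.2.not_ge]
  · simpa using hvV
  · simpa [hℓ0.not_ge] using hwV

theorem IsGraphModel.exists_edgeAtlas [CompactSpace G] {V : Set G} (hV : IsGraphModel V) :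
    Nonempty (EdgeAtlas V) := by
  choose len map h using fun e : compsOf Vᶜ => exists_edge_chart e.2 (hV.2.2 e e.2)
  exact ⟨⟨hV.1, hV.2.1, len, map, fun e => (h e).1, fun e => (h e).2.1, fun e => (h e).2.2.1,
    fun e => (h e).2.2.2.1, fun e => (h e).2.2.2.2⟩⟩

namespace EdgeAtlas

variable {V : Set G} (K : EdgeAtlas V)

theorem map_notMem {e : compsOf Vᶜ} {t : ℝ} (ht : t ∈ Ioo 0 (K.len e)) : K.map e t ∉ V := by
  have h : K.map e t ∈ (e : Set G) := by rw [← K.range e]; exact ⟨t, ht, rfl⟩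
  exact subset_of_mem_compsOf e.2 h

theorem map_mem {e : compsOf Vᶜ} {t : ℝ} (ht : t ∈ Ioo 0 (K.len e)) :
    K.map e t ∈ (e : Set G) := by rw [← K.range e]; exact ⟨t, ht, rfl⟩

theorem map_inj {e : compsOf Vᶜ} {s t : ℝ} (hs : s ∈ Icc 0 (K.len e)) (ht : t ∈ Icc 0 (K.len e))
    (h : K.map e s = K.map e t) : s = t := by
  have := K.isom e s hs t ht
  rw [h, dist_self] at this
  linarith [abs_eq_zero.1 this.symm]

theorem exists_map_eq {x : G} (hx : x ∉ V) :
    ∃ e, ∃ t ∈ Ioo 0 (K.len e), K.map e t = x := by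
  have h := mem_connectedComponentIn (F := Vᶜ) hx
  have h2 := K.range ⟨_, connectedComponentIn_mem_compsOf hx⟩
  simp only at h2
  rw [← h2] at h
  obtain ⟨t, ht, h⟩ := h
  exact ⟨_, t, ht, h⟩

theorem map_eq_map {e e' : compsOf Vᶜ} {t t' : ℝ} (ht : t ∈ Ioo 0 (K.len e))
    (ht' : t' ∈ Icc 0 (K.len e')) (h : K.map e t = K.map e' t') : e = e' ∧ t = t' := by
  have h0 := K.map_notMem ht
  have ht1 : t' ∈ Ioo 0 (K.len e') := by
    refine ⟨lt_of_le_of_ne ht'.1 ?_, lt_of_le_of_ne ht'.2 ?_⟩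
    · rintro rfl
      exact h0 (h ▸ K.left e')
    · rintro rfl
      exact h0 (h ▸ K.right e')
  have he : e = e' := by
    apply Subtype.ext
    exact eq_of_mem_compsOf e.2 e'.2 (K.map_mem ht) (h ▸ K.map_mem ht1)
  subst he
  exact ⟨rfl, K.map_inj (Ioo_subset_Icc_self ht) ht' h⟩

theorem continuousOn_map (e : compsOf Vᶜ) : ContinuousOn (K.map e) (Icc 0 (K.len e)) := by
  have : LipschitzOnWith 1 (K.map e) (Icc 0 (K.len e)) :=
    LipschitzOnWith.of_dist_le_mul fun x hx y hy => by
      rw [K.isom e x hx y hy, NNReal.coe_one, one_mul, Real.dist_eq]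
  exact this.continuousOn

theorem isClosed_image (e : compsOf Vᶜ) : IsClosed (K.map e '' Icc 0 (K.len e)) :=
  (isCompact_Icc.image_of_continuousOn (K.continuousOn_map e)).isClosed

end EdgeAtlas

/-! ### Tangent directions -/

/-- A representative of a tangent direction. -/
noncomputable def dirPath {x : G} (ζ : TangentDir x) : ℝ → G := (Quotient.out ζ).1

theorem dirPath_unitSpeed {x : G} (ζ : TangentDir x) :
    ∃ ε > (0:ℝ), IsUnitSpeedFrom x ε (dirPath ζ) := (Quotient.out ζ).2

theorem dirPath_zero {x : G} (ζ : TangentDir x) : dirPath ζ 0 = x := by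
  obtain ⟨ε, _, h⟩ := dirPath_unitSpeed ζ
  exact h.1

/-- The germ of a unit speed path. -/
def germ {x : G} (γ : ℝ → G) (h : ∃ ε > (0:ℝ), IsUnitSpeedFrom x ε γ) : TangentDir x :=
  Quotient.mk (germSetoid x) ⟨γ, h⟩

theorem dirPath_germ {x : G} {γ : ℝ → G} (h : ∃ ε > (0:ℝ), IsUnitSpeedFrom x ε γ) :
    ∃ δ > (0:ℝ), ∀ t ∈ Ico (0:ℝ) δ, dirPath (germ γ h) t = γ t :=
  Quotient.exact (Quotient.out_eq (germ γ h))

theorem tangentDir_ext {x : G} {ζ η : TangentDir x} {δ : ℝ} (hδ : 0 < δ)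
    (h : ∀ t ∈ Ico (0:ℝ) δ, dirPath ζ t = dirPath η t) : ζ = η := by
  rw [← Quotient.out_eq ζ, ← Quotient.out_eq η]
  exact Quotient.sound ⟨δ, hδ, h⟩

theorem IsUnitSpeedFrom.continuousOn {x : G} {ε : ℝ} {γ : ℝ → G} (h : IsUnitSpeedFrom x ε γ) :
    ContinuousOn γ (Ico 0 ε) := by
  have : LipschitzOnWith 1 γ (Ico 0 ε) :=
    LipschitzOnWith.of_dist_le_mul fun x hx y hy => by
      rw [h.2 x hx y hy, NNReal.coe_one, one_mul, Real.dist_eq]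
  exact this.continuousOn

theorem IsUnitSpeedFrom.injOn {x : G} {ε : ℝ} {γ : ℝ → G} (h : IsUnitSpeedFrom x ε γ) :
    InjOn γ (Ico 0 ε) := by
  intro s hs t ht hst
  have := h.2 s hs t ht
  rw [hst, dist_self] at this
  linarith [abs_eq_zero.1 this.symm]

/-- An isometric map of an open interval into the line is affine with slope `±1`. -/
theorem exists_affine_of_isometric {δ : ℝ} (hδ : 0 < δ) {u : ℝ → ℝ}
    (hu : ∀ s ∈ Ioo 0 δ, ∀ t ∈ Ioo 0 δ, |u s - u t| = |s - t|) :
    ∃ c σ : ℝ, (σ = 1 ∨ σ = -1) ∧ ∀ s ∈ Ioo 0 δ, u s = c + σ * s := by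
  have hp : δ/3 ∈ Ioo 0 δ := ⟨by linarith, by linarith⟩
  have hq : δ/2 ∈ Ioo 0 δ := ⟨by linarith, by linarith⟩
  have key : ∀ s ∈ Ioo 0 δ, (u s - u (δ/3) = s - δ/3 ∨ u s - u (δ/3) = -(s - δ/3)) ∧
      (u s - u (δ/2) = s - δ/2 ∨ u s - u (δ/2) = -(s - δ/2)) := fun s hs =>
    ⟨abs_eq_abs.1 (hu s hs _ hp), abs_eq_abs.1 (hu s hs _ hq)⟩
  rcases (key _ hp).2 with h | h
  · refine ⟨u (δ/3) - δ/3, 1, Or.inl rfl, fun s hs => ?_⟩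
    rcases key s hs with ⟨h1 | h1, h2 | h2⟩ <;> linarith
  · refine ⟨u (δ/3) + δ/3, -1, Or.inr rfl, fun s hs => ?_⟩
    rcases key s hs with ⟨h1 | h1, h2 | h2⟩ <;> linarith

namespace EdgeAtlas

variable {V : Set G} (K : EdgeAtlas V)

/-- Every unit speed path starts by following an edge. -/
theorem exists_eq_map {x : G} {ε : ℝ} (hε : 0 < ε) {γ : ℝ → G} (hγ : IsUnitSpeedFrom x ε γ) :
    ∃ e, ∃ t₀ σ δ : ℝ, (σ = 1 ∨ σ = -1) ∧ 0 < δ ∧ δ ≤ ε ∧ t₀ ∈ Icc 0 (K.len e) ∧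
      K.map e t₀ = x ∧
      ∀ s ∈ Ioo 0 δ, t₀ + σ * s ∈ Ioo 0 (K.len e) ∧ γ s = K.map e (t₀ + σ * s) := by
  have hW : (Ioo 0 ε ∩ γ ⁻¹' V).Finite :=
    Finite.of_finite_image (K.finV.subset (by rintro _ ⟨s, hs, rfl⟩; exact hs.2))
      (hγ.injOn.mono fun s hs => Ioo_subset_Ico_self hs.1)
  obtain ⟨δ, hδ0, hδε, hδ⟩ : ∃ δ, 0 < δ ∧ δ ≤ ε ∧ ∀ s ∈ Ioo 0 δ, γ s ∉ V := by
    have h0 : (0:ℝ) ∉ Ioo 0 ε ∩ γ ⁻¹' V := fun h => lt_irrefl _ h.1.1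
    obtain ⟨η, hη, hη'⟩ := Metric.isOpen_iff.1 hW.isClosed.isOpen_compl 0 h0
    refine ⟨min η ε, lt_min hη hε, min_le_right _ _, fun s hs hsV => ?_⟩
    have hs1 := hs.2.trans_le (min_le_left _ _)
    have hs2 := hs.2.trans_le (min_le_right _ _)
    have hb : s ∈ Metric.ball (0:ℝ) η := by
      rw [Metric.mem_ball, Real.dist_eq, sub_zero, abs_of_pos hs.1]
      exact hs1
    exact hη' hb ⟨⟨hs.1, hs2⟩, hsV⟩
  have hsub : Ioo 0 δ ⊆ Ico 0 ε := fun s hs => ⟨hs.1.le, hs.2.trans_le hδε⟩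
  have hmid : δ/2 ∈ Ioo 0 δ := ⟨by linarith, by linarith⟩
  let e : compsOf Vᶜ := ⟨_, connectedComponentIn_mem_compsOf (hδ _ hmid)⟩
  have hin : ∀ s ∈ Ioo 0 δ, γ s ∈ (e : Set G) := by
    have hpc : IsPreconnected (γ '' Ioo 0 δ) :=
      isPreconnected_Ioo.image _ (hγ.continuousOn.mono hsub)
    have := hpc.subset_connectedComponentIn (F := Vᶜ) (mem_image_of_mem γ hmid)
      (by rintro _ ⟨s, hs, rfl⟩; exact hδ s hs)
    exact fun s hs => this (mem_image_of_mem γ hs)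
  have hex : ∀ s, ∃ r, s ∈ Ioo 0 δ → r ∈ Ioo 0 (K.len e) ∧ K.map e r = γ s := by
    intro s
    by_cases hs : s ∈ Ioo 0 δ
    · have := hin s hs
      rw [← K.range e] at this
      obtain ⟨r, hr, h⟩ := this
      exact ⟨r, fun _ => ⟨hr, h⟩⟩
    · exact ⟨0, fun h => absurd h hs⟩
  choose u hu using hex
  obtain ⟨c, σ, hσ, hc⟩ := exists_affine_of_isometric hδ0 (u := u) (by
    intro s hs t ht
    rw [← K.isom e _ (Ioo_subset_Icc_self (hu s hs).1) _ (Ioo_subset_Icc_self (hu t ht).1),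
      (hu s hs).2, (hu t ht).2, hγ.2 s (hsub hs) t (hsub ht)])
  have hcI : ∀ s ∈ Ioo 0 δ, c + σ * s ∈ Ioo 0 (K.len e) := fun s hs => by
    rw [← hc s hs]; exact (hu s hs).1
  have hc0 : c ∈ Icc 0 (K.len e) := by
    constructor
    · by_contra! h
      have hm : min (δ/2) (-c/2) ∈ Ioo 0 δ :=
        ⟨lt_min (by linarith) (by linarith), (min_le_left _ _).trans_lt hmid.2⟩
      have := (hcI _ hm).1
      have h2 := min_le_right (δ/2) (-c/2)
      rcases hσ with rfl | rfl <;> linarith [hm.1]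
    · by_contra! h
      have hm : min (δ/2) ((c - K.len e)/2) ∈ Ioo 0 δ :=
        ⟨lt_min (by linarith) (by linarith), (min_le_left _ _).trans_lt hmid.2⟩
      have := (hcI _ hm).2
      have h2 := min_le_right (δ/2) ((c - K.len e)/2)
      rcases hσ with rfl | rfl <;> linarith [hm.1]
  have hval : ∀ s ∈ Ioo 0 δ, γ s = K.map e (c + σ * s) := fun s hs => by
    rw [← hc s hs, (hu s hs).2]
  refine ⟨e, c, σ, δ, hσ, hδ0, hδε, hc0, ?_, fun s hs => ⟨hcI s hs, hval s hs⟩⟩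
  rw [← dist_le_zero]
  apply le_of_forall_pos_le_add
  intro η hη
  have hm : min (δ/2) (η/2) ∈ Ioo 0 δ :=
    ⟨lt_min (by linarith) (by linarith), (min_le_left _ _).trans_lt hmid.2⟩
  set s := min (δ/2) (η/2)
  have h2 : s ≤ η/2 := min_le_right (δ/2) (η/2)
  have d1 : dist (K.map e c) (γ s) = s := by
    rw [hval s hm, K.isom e c hc0 _ (Ioo_subset_Icc_self (hcI s hm))]
    rcases hσ with rfl | rfl <;> simp [abs_of_pos hm.1]
  have d2 : dist x (γ s) = s := by
    rw [← hγ.1, hγ.2 0 ⟨le_rfl, hε⟩ s (hsub hm), zero_sub, abs_neg, abs_of_pos hm.1]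
  have := dist_triangle_right (K.map e c) x (γ s)
  linarith

theorem isUnitSpeedFrom_map {e : compsOf Vᶜ} {t₀ σ ε : ℝ} (hσ : σ = 1 ∨ σ = -1)
    (h : ∀ s ∈ Ico 0 ε, t₀ + σ * s ∈ Icc 0 (K.len e)) :
    IsUnitSpeedFrom (K.map e t₀) ε (fun s => K.map e (t₀ + σ * s)) := by
  refine ⟨by simp, fun s hs t ht => ?_⟩
  simp only
  rw [K.isom e _ (h s hs) _ (h t ht)]
  rcases hσ with rfl | rfl
  · congr 1; ring
  · rw [abs_sub_comm s t]; congr 1; ring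

theorem eq_of_map_eq {e e' : compsOf Vᶜ} {t t' σ σ' s : ℝ} (ht : t ∈ Icc 0 (K.len e))
    (ht' : t' ∈ Icc 0 (K.len e')) (hs : 0 < s)
    (h1 : t + σ * s ∈ Ioo 0 (K.len e)) (h2 : t' + σ' * s ∈ Icc 0 (K.len e'))
    (h0 : K.map e t = K.map e' t') (h : K.map e (t + σ * s) = K.map e' (t' + σ' * s)) :
    e = e' ∧ t = t' ∧ σ = σ' := by
  obtain ⟨rfl, h3⟩ := K.map_eq_map h1 h2 h
  have h4 := K.map_inj ht ht' h0
  subst h4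
  refine ⟨rfl, rfl, ?_⟩
  have : σ * s = σ' * s := by linarith
  exact mul_right_cancel₀ hs.ne' this

/-- Coordinates of a tangent direction. -/
theorem exists_dir_coords {x : G} (ζ : TangentDir x) :
    ∃ e, ∃ t₀ σ δ : ℝ, (σ = 1 ∨ σ = -1) ∧ 0 < δ ∧ t₀ ∈ Icc 0 (K.len e) ∧ K.map e t₀ = x ∧
      ∀ s ∈ Ioo 0 δ, t₀ + σ * s ∈ Ioo 0 (K.len e) ∧ dirPath ζ s = K.map e (t₀ + σ * s) := by
  obtain ⟨ε, hε, h⟩ := dirPath_unitSpeed ζ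
  obtain ⟨e, t₀, σ, δ, h1, h2, -, h4⟩ := K.exists_eq_map hε h
  exact ⟨e, t₀, σ, δ, h1, h2, h4⟩

theorem finite_tangentDir {V : Set G} (K : EdgeAtlas V) (x : G) : Finite (TangentDir x) := by
  have := K.finE
  choose e t₀ σ δ hσ hδ ht hx hγ using fun ζ : TangentDir x => K.exists_dir_coords ζ
  have hinj : Injective (fun ζ => (e ζ, decide (σ ζ = 1))) := by
    intro ζ η h
    obtain ⟨he, hs⟩ := Prod.ext_iff.1 h
    simp only at he hs
    have hσ' : σ ζ = σ η := by
      rcases hσ ζ with h1 | h1 <;> rcases hσ η with h2 | h2 <;> rw [h1, h2] at hs ⊢ <;>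
        norm_num at hs
    have ht' : t₀ ζ = t₀ η := by
      have h3 := hx ζ
      rw [← hx η, he] at h3
      exact K.map_inj (he ▸ ht ζ) (ht η) h3
    refine tangentDir_ext (lt_min (hδ ζ) (hδ η)) fun t ht => ?_
    rcases ht.1.eq_or_lt with h0 | h0
    · rw [← h0, dirPath_zero, dirPath_zero]
    · rw [(hγ ζ t ⟨h0, ht.2.trans_le (min_le_left _ _)⟩).2,
        (hγ η t ⟨h0, ht.2.trans_le (min_le_right _ _)⟩).2, ht', hσ', he]
  exact Finite.of_injective _ hinj

end EdgeAtlas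

/-! ### Slopes and orders of rational functions -/

theorem HasSlopeAlong.unique {f : G → ℝ} {γ : ℝ → G} {s s' : ℤ} (h : HasSlopeAlong f γ s)
    (h' : HasSlopeAlong f γ s') : s = s' := by
  obtain ⟨δ, hδ, h⟩ := h
  obtain ⟨δ', hδ', h'⟩ := h'
  have hm : 0 < min (δ/2) (δ'/2) := lt_min (by linarith) (by linarith)
  have h1 := h _ ⟨hm.le, (min_le_left _ _).trans_lt (by linarith)⟩
  have h2 := h' _ ⟨hm.le, (min_le_right _ _).trans_lt (by linarith)⟩
  have h3 : (s:ℝ) * min (δ/2) (δ'/2) = s' * min (δ/2) (δ'/2) := by linarith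
  exact_mod_cast mul_right_cancel₀ hm.ne' h3

theorem HasSlopeAlong.congr {f : G → ℝ} {γ γ' : ℝ → G} {s : ℤ} {δ : ℝ} (hδ : 0 < δ)
    (h : ∀ t ∈ Ico (0:ℝ) δ, γ t = γ' t) (hs : HasSlopeAlong f γ s) : HasSlopeAlong f γ' s := by
  obtain ⟨η, hη, h'⟩ := hs
  refine ⟨min δ η, lt_min hδ hη, fun t ht => ?_⟩
  rw [← h t ⟨ht.1, ht.2.trans_le (min_le_left _ _)⟩, ← h 0 ⟨le_rfl, hδ⟩]
  exact h' t ⟨ht.1, ht.2.trans_le (min_le_right _ _)⟩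

theorem HasSlopeAlong.add {f g : G → ℝ} {γ : ℝ → G} {s s' : ℤ} (h : HasSlopeAlong f γ s)
    (h' : HasSlopeAlong g γ s') : HasSlopeAlong (fun x => f x + g x) γ (s + s') := by
  obtain ⟨δ, hδ, h⟩ := h
  obtain ⟨δ', hδ', h'⟩ := h'
  refine ⟨min δ δ', lt_min hδ hδ', fun t ht => ?_⟩
  simp only
  rw [h t ⟨ht.1, ht.2.trans_le (min_le_left _ _)⟩, h' t ⟨ht.1, ht.2.trans_le (min_le_right _ _)⟩]
  push_cast; ring

theorem HasSlopeAlong.neg {f : G → ℝ} {γ : ℝ → G} {s : ℤ} (h : HasSlopeAlong f γ s) :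
    HasSlopeAlong (fun x => -f x) γ (-s) := by
  obtain ⟨δ, hδ, h⟩ := h
  refine ⟨δ, hδ, fun t ht => ?_⟩
  simp only
  rw [h t ht]
  push_cast; ring

theorem hasSlopeAlong_const (c : ℝ) (γ : ℝ → G) : HasSlopeAlong (fun _ => c) γ 0 :=
  ⟨1, one_pos, fun t _ => by simp⟩

/-- The slope of the maximum of a function with a constant. -/
theorem HasSlopeAlong.max_const {f : G → ℝ} {γ : ℝ → G} {s : ℤ} (h : HasSlopeAlong f γ s)
    (c : ℝ) : HasSlopeAlong (fun x => max (f x) c) γ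
      (if f (γ 0) = c then max s 0 else if f (γ 0) < c then 0 else s) := by
  obtain ⟨δ, hδ, h⟩ := h
  have key : ∀ d > 0, ∃ η > 0, η ≤ δ ∧ ∀ t ∈ Ico (0:ℝ) η, |s * t| ≤ d := by
    intro d hd
    have hpos : (0:ℝ) < |(s:ℝ)| + 1 := by positivity
    refine ⟨min δ (d / (|(s:ℝ)| + 1)), lt_min hδ (by positivity), min_le_left _ _, fun t ht => ?_⟩
    have h2 := ht.2.trans_le (min_le_right _ _)
    rw [lt_div_iff₀ hpos] at h2
    rw [abs_mul, abs_of_nonneg ht.1]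
    nlinarith [ht.1]
  rcases lt_trichotomy (f (γ 0)) c with hc | hc | hc
  · rw [if_neg hc.ne, if_pos hc]
    obtain ⟨η, hη, hηδ, hb⟩ := key (c - f (γ 0)) (by linarith)
    refine ⟨η, hη, fun t ht => ?_⟩
    have := abs_le.1 (hb t ht)
    simp only
    rw [h t ⟨ht.1, ht.2.trans_le hηδ⟩, max_eq_right (by linarith), max_eq_right hc.le]
    simp
  · rw [if_pos hc]
    refine ⟨δ, hδ, fun t ht => ?_⟩
    simp only
    rw [h t ht, hc, max_self]
    rcases le_total s 0 with hs | hs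
    · have : (s:ℝ) ≤ 0 := by exact_mod_cast hs
      rw [max_eq_right hs, max_eq_right (by nlinarith [ht.1])]; simp
    · have : (0:ℝ) ≤ s := by exact_mod_cast hs
      rw [max_eq_left hs, max_eq_left (by nlinarith [ht.1])]
  · rw [if_neg hc.ne', if_neg hc.not_gt]
    obtain ⟨η, hη, hηδ, hb⟩ := key (f (γ 0) - c) (by linarith)
    refine ⟨η, hη, fun t ht => ?_⟩
    have := abs_le.1 (hb t ht)
    simp only
    rw [h t ⟨ht.1, ht.2.trans_le hηδ⟩, max_eq_left (by linarith), max_eq_left hc.le]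

theorem tangentSlope_eq {f : G → ℝ} {x : G} {ζ : TangentDir x} {s : ℤ}
    (h : HasSlopeAlong f (dirPath ζ) s) : tangentSlope f ζ = s := by
  have hex : ∃ s : ℤ, HasSlopeAlong f (Quotient.out ζ).1 s := ⟨s, h⟩
  rw [tangentSlope, dif_pos hex]
  exact hex.choose_spec.unique h

theorem tangentSlope_germ {f : G → ℝ} {x : G} {γ : ℝ → G}
    (hγ : ∃ ε > (0:ℝ), IsUnitSpeedFrom x ε γ) {s : ℤ} (h : HasSlopeAlong f γ s) :
    tangentSlope f (germ γ hγ) = s := by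
  obtain ⟨δ, hδ, hd⟩ := dirPath_germ hγ
  exact tangentSlope_eq (h.congr hδ fun t ht => (hd t ht).symm)

namespace IsRational

variable {f g : G → ℝ}

theorem hasSlopeAlong (hf : IsRational f) {x : G} (ζ : TangentDir x) :
    HasSlopeAlong f (dirPath ζ) (tangentSlope f ζ) := by
  obtain ⟨ε, hε, h⟩ := dirPath_unitSpeed ζ
  obtain ⟨s, hs⟩ := hf.2 x ε _ hε h
  rwa [tangentSlope_eq hs]

theorem add (hf : IsRational f) (hg : IsRational g) : IsRational (fun x => f x + g x) := by
  refine ⟨hf.1.add hg.1, fun x ε γ hε hγ => ?_⟩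
  obtain ⟨s, hs⟩ := hf.2 x ε γ hε hγ
  obtain ⟨s', hs'⟩ := hg.2 x ε γ hε hγ
  exact ⟨_, hs.add hs'⟩

theorem neg (hf : IsRational f) : IsRational (fun x => -f x) := by
  refine ⟨hf.1.neg, fun x ε γ hε hγ => ?_⟩
  obtain ⟨s, hs⟩ := hf.2 x ε γ hε hγ
  exact ⟨_, hs.neg⟩

theorem max_const (hf : IsRational f) (c : ℝ) : IsRational (fun x => max (f x) c) := by
  refine ⟨hf.1.max continuous_const, fun x ε γ hε hγ => ?_⟩
  obtain ⟨s, hs⟩ := hf.2 x ε γ hε hγ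
  exact ⟨_, hs.max_const c⟩

theorem tangentSlope_add (hf : IsRational f) (hg : IsRational g) {x : G} (ζ : TangentDir x) :
    tangentSlope (fun x => f x + g x) ζ = tangentSlope f ζ + tangentSlope g ζ :=
  tangentSlope_eq ((hf.hasSlopeAlong ζ).add (hg.hasSlopeAlong ζ))

theorem tangentSlope_neg (hf : IsRational f) {x : G} (ζ : TangentDir x) :
    tangentSlope (fun x => -f x) ζ = -tangentSlope f ζ :=
  tangentSlope_eq (hf.hasSlopeAlong ζ).neg

theorem tangentSlope_max_const (hf : IsRational f) (c : ℝ) {x : G} (ζ : TangentDir x) :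
    tangentSlope (fun x => max (f x) c) ζ =
      if f x = c then max (tangentSlope f ζ) 0 else if f x < c then 0 else tangentSlope f ζ := by
  have := tangentSlope_eq ((hf.hasSlopeAlong ζ).max_const c)
  rwa [dirPath_zero] at this

end IsRational

theorem isRational_const (c : ℝ) : IsRational (fun _ : G => c) :=
  ⟨continuous_const, fun _ _ γ _ _ => ⟨0, hasSlopeAlong_const c γ⟩⟩

theorem ordAt_const (c : ℝ) (x : G) : ordAt (fun _ : G => c) x = 0 := by
  have : ∀ ζ : TangentDir x, tangentSlope (fun _ : G => c) ζ = 0 := fun ζ =>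
    tangentSlope_eq (hasSlopeAlong_const c _)
  simp [ordAt, this]

theorem ordAt_add [∀ x : G, Finite (TangentDir x)] {f g : G → ℝ} (hf : IsRational f)
    (hg : IsRational g) (x : G) : ordAt (fun x => f x + g x) x = ordAt f x + ordAt g x := by
  simp only [ordAt, hf.tangentSlope_add hg]
  exact finsum_add_distrib (toFinite _) (toFinite _)

theorem ordAt_neg {f : G → ℝ} (hf : IsRational f) (x : G) :
    ordAt (fun x => -f x) x = -ordAt f x := by
  simp only [ordAt, hf.tangentSlope_neg]
  exact finsum_neg_distrib _

namespace EdgeAtlas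

variable {V : Set G} (K : EdgeAtlas V)

theorem hasSlopeAlong_map {f : G → ℝ} (hf : IsRational f) {e : compsOf Vᶜ} {t σ ε : ℝ}
    (hσ : σ = 1 ∨ σ = -1) (hε : 0 < ε) (h : ∀ s ∈ Ico 0 ε, t + σ * s ∈ Icc 0 (K.len e)) :
    HasSlopeAlong f (fun s => K.map e (t + σ * s))
      (tangentSlope f (germ _ ⟨ε, hε, K.isUnitSpeedFrom_map hσ h⟩)) := by
  obtain ⟨s, hs⟩ := hf.2 _ _ _ hε (K.isUnitSpeedFrom_map hσ h)
  rwa [tangentSlope_germ _ hs]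

theorem exists_two_dirs {e : compsOf Vᶜ} {t : ℝ} (ht : t ∈ Ioo 0 (K.len e)) :
    ∃ ζ η : TangentDir (K.map e t), ζ ≠ η ∧ (∀ ξ, ξ = ζ ∨ ξ = η) ∧
      ∃ δ > 0, ∀ s ∈ Ico 0 δ, dirPath ζ s = K.map e (t + s) ∧ dirPath η s = K.map e (t - s) := by
  set ε := min t (K.len e - t) with hε
  have hε0 : 0 < ε := lt_min ht.1 (by linarith [ht.2])
  have e1 : ε ≤ t := min_le_left _ _
  have e2 : ε ≤ K.len e - t := min_le_right _ _
  have hI : ∀ σ : ℝ, (σ = 1 ∨ σ = -1) → ∀ s ∈ Ico 0 ε, t + σ * s ∈ Ioo 0 (K.len e) := by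
    rintro σ (rfl | rfl) s ⟨h1, h2⟩ <;> constructor <;> linarith [ht.1, ht.2]
  let ζ : TangentDir (K.map e t) := germ _ ⟨ε, hε0, K.isUnitSpeedFrom_map (Or.inl rfl)
    fun s hs => Ioo_subset_Icc_self (hI 1 (Or.inl rfl) s hs)⟩
  let η : TangentDir (K.map e t) := germ _ ⟨ε, hε0, K.isUnitSpeedFrom_map (Or.inr rfl)
    fun s hs => Ioo_subset_Icc_self (hI (-1) (Or.inr rfl) s hs)⟩
  obtain ⟨δ₁, hδ₁, h1⟩ : ∃ δ > 0, ∀ s ∈ Ico 0 δ, dirPath ζ s = K.map e (t + 1 * s) :=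
    dirPath_germ _
  obtain ⟨δ₂, hδ₂, h2⟩ : ∃ δ > 0, ∀ s ∈ Ico 0 δ, dirPath η s = K.map e (t + (-1) * s) :=
    dirPath_germ _
  refine ⟨ζ, η, ?_, ?_, min δ₁ δ₂, lt_min hδ₁ hδ₂, fun s hs => ⟨?_, ?_⟩⟩
  · intro h
    set s := min (min δ₁ δ₂) ε / 2 with hs
    have hm : 0 < min (min δ₁ δ₂) ε := lt_min (lt_min hδ₁ hδ₂) hε0
    have hs0 : 0 < s := by linarith
    have hs1 : s < δ₁ := by
      have := (min_le_left (min δ₁ δ₂) ε).trans (min_le_left _ _); linarith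
    have hs2 : s < δ₂ := by
      have := (min_le_left (min δ₁ δ₂) ε).trans (min_le_right _ _); linarith
    have hs3 : s < ε := by
      have := min_le_right (min δ₁ δ₂) ε; linarith
    have h3 := h1 s ⟨hs0.le, hs1⟩
    rw [h, h2 s ⟨hs0.le, hs2⟩] at h3
    have := K.map_inj (Ioo_subset_Icc_self (hI (-1) (Or.inr rfl) s ⟨hs0.le, hs3⟩))
      (Ioo_subset_Icc_self (hI 1 (Or.inl rfl) s ⟨hs0.le, hs3⟩)) h3
    linarith
  · intro ξ
    obtain ⟨e', t', σ, δ, hσ, hδ, ht', hx, hξ⟩ := K.exists_dir_coords ξ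
    obtain ⟨rfl, rfl⟩ := K.map_eq_map ht ht' hx.symm
    rcases hσ with rfl | rfl
    · left
      refine tangentDir_ext (lt_min hδ hδ₁) fun s hs => ?_
      rcases hs.1.eq_or_lt with h0 | h0
      · rw [← h0, dirPath_zero, dirPath_zero]
      · rw [(hξ s ⟨h0, hs.2.trans_le (min_le_left _ _)⟩).2,
          h1 s ⟨hs.1, hs.2.trans_le (min_le_right _ _)⟩]
    · right
      refine tangentDir_ext (lt_min hδ hδ₂) fun s hs => ?_
      rcases hs.1.eq_or_lt with h0 | h0
      · rw [← h0, dirPath_zero, dirPath_zero]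
      · rw [(hξ s ⟨h0, hs.2.trans_le (min_le_left _ _)⟩).2,
          h2 s ⟨hs.1, hs.2.trans_le (min_le_right _ _)⟩]
  · rw [h1 s ⟨hs.1, hs.2.trans_le (min_le_left _ _)⟩, one_mul]
  · rw [h2 s ⟨hs.1, hs.2.trans_le (min_le_right _ _)⟩, neg_one_mul, sub_eq_add_neg]

theorem exists_two_dirs_of_notMem {V : Set G} (K : EdgeAtlas V) {x : G} (hx : x ∉ V) :
    ∃ ζ η : TangentDir x, ζ ≠ η ∧ ∀ ξ, ξ = ζ ∨ ξ = η := by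
  obtain ⟨e, t, ht, rfl⟩ := K.exists_map_eq hx
  obtain ⟨ζ, η, h1, h2, -⟩ := K.exists_two_dirs ht
  exact ⟨ζ, η, h1, h2⟩

/-- The order at an interior point of an edge is the sum of the two slopes. -/
theorem exists_slopes {f : G → ℝ} (hf : IsRational f) {e : compsOf Vᶜ} {t : ℝ}
    (ht : t ∈ Ioo 0 (K.len e)) :
    ∃ L R : ℤ, ordAt f (K.map e t) = L + R ∧ ∃ δ > 0, ∀ s ∈ Ico 0 δ,
      f (K.map e (t + s)) = f (K.map e t) + R * s ∧
      f (K.map e (t - s)) = f (K.map e t) + L * s := by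
  obtain ⟨ζ, η, hne, hall, δ, hδ, h⟩ := K.exists_two_dirs ht
  obtain ⟨δ₁, hδ₁, h1⟩ := hf.hasSlopeAlong ζ
  obtain ⟨δ₂, hδ₂, h2⟩ := hf.hasSlopeAlong η
  refine ⟨tangentSlope f η, tangentSlope f ζ, ?_, min δ (min δ₁ δ₂),
    lt_min hδ (lt_min hδ₁ hδ₂), fun s hs => ?_⟩
  · have huniv : (univ : Set (TangentDir (K.map e t))) = {η, ζ} := by
      ext ξ; simpa using (hall ξ).symm
    rw [ordAt, ← finsum_mem_univ, huniv, finsum_mem_pair hne.symm]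
  · have hs0 := hs.2.trans_le (min_le_left _ _)
    have hs' := hs.2.trans_le (min_le_right _ _)
    have hs1 := hs'.trans_le (min_le_left _ _)
    have hs2 := hs'.trans_le (min_le_right _ _)
    have e1 := h1 s ⟨hs.1, hs1⟩
    have e2 := h2 s ⟨hs.1, hs2⟩
    rw [dirPath_zero, (h s ⟨hs.1, hs0⟩).1] at e1
    rw [dirPath_zero, (h s ⟨hs.1, hs0⟩).2] at e2
    exact ⟨e1, e2⟩

end EdgeAtlas

/-! ### Star-shaped balls -/

/-- The ball of radius `r` about `x` is a star whose branches are the tangent directions at `x`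
and whose points other than `x` are interior to edges. -/
structure StarRadius (V : Set G) (x : G) (r : ℝ) : Prop where
  pos : 0 < r
  unitSpeed : ∀ ζ : TangentDir x, IsUnitSpeedFrom x r (dirPath ζ)
  notMem : ∀ ζ : TangentDir x, ∀ t ∈ Ioo 0 r, dirPath ζ t ∉ V
  slopes : ∀ ζ : TangentDir x, ∀ t ∈ Ioo 0 r, ∀ f : G → ℝ, IsRational f →
    ∃ L R : ℤ, ordAt f (dirPath ζ t) = L + R ∧ ∃ δ > 0, ∀ s ∈ Ico 0 δ,
      f (dirPath ζ (t + s)) = f (dirPath ζ t) + R * s ∧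
      f (dirPath ζ (t - s)) = f (dirPath ζ t) + L * s
  cover : ∀ y, dist x y < r → y ≠ x → ∃ ζ : TangentDir x, dirPath ζ (dist x y) = y
  inj : ∀ ζ η : TangentDir x, ∀ t ∈ Ioo 0 r, dirPath ζ t = dirPath η t → ζ = η

theorem StarRadius.mono {V : Set G} {x : G} {r r' : ℝ} (h : StarRadius V x r) (h0 : 0 < r')
    (hr : r' ≤ r) : StarRadius V x r' where
  pos := h0
  unitSpeed ζ := ⟨(h.unitSpeed ζ).1, fun s hs t ht => (h.unitSpeed ζ).2 s
    ⟨hs.1, hs.2.trans_le hr⟩ t ⟨ht.1, ht.2.trans_le hr⟩⟩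
  notMem ζ t ht := h.notMem ζ t ⟨ht.1, ht.2.trans_le hr⟩
  slopes ζ t ht := h.slopes ζ t ⟨ht.1, ht.2.trans_le hr⟩
  cover y hy := h.cover y (hy.trans_le hr)
  inj ζ η t ht := h.inj ζ η t ⟨ht.1, ht.2.trans_le hr⟩

theorem StarRadius.dist_dirPath {V : Set G} {x : G} {r : ℝ} (h : StarRadius V x r)
    (ζ : TangentDir x) {t : ℝ} (ht : t ∈ Ico 0 r) : dist x (dirPath ζ t) = t := by
  have := (h.unitSpeed ζ).2 0 ⟨le_rfl, h.pos⟩ t ht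
  rwa [dirPath_zero, zero_sub, abs_neg, abs_of_nonneg ht.1] at this

theorem exists_pos_le_of_finite {ι : Type*} [Finite ι] (δ : ι → ℝ) (h : ∀ i, 0 < δ i) :
    ∃ r > 0, ∀ i, r ≤ δ i := by
  have h1 : ∀ᶠ r in nhdsWithin (0:ℝ) (Ioi 0), ∀ i, r ≤ δ i :=
    Filter.eventually_all.2 fun i => by
      filter_upwards [Ioo_mem_nhdsGT (h i)] with r hr using hr.2.le
  obtain ⟨r, hr, hr'⟩ := (h1.and self_mem_nhdsWithin).exists
  exact ⟨r, hr', hr⟩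

theorem exists_starRadius {V : Set G} (K : EdgeAtlas V) (x : G) : ∃ r, StarRadius V x r := by
  have := K.finE
  have := K.finite_tangentDir x
  choose e t₀ σ δ hσ hδ ht hx hγ using fun ζ : TangentDir x => K.exists_dir_coords ζ
  obtain ⟨r₁, hr₁, h1⟩ := exists_pos_le_of_finite δ hδ
  obtain ⟨r₂, hr₂, h2⟩ : ∃ r > 0, ∀ y ∈ V, dist x y < r → y = x := by
    have hc : IsClosed (V \ {x}) := (K.finV.subset sdiff_subset).isClosed
    obtain ⟨r, hr, h⟩ := Metric.isOpen_iff.1 hc.isOpen_compl x (by simp)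
    refine ⟨r, hr, fun y hy hd => ?_⟩
    by_contra hne
    exact h (by rwa [Metric.mem_ball, dist_comm] : y ∈ Metric.ball x r) ⟨hy, hne⟩
  obtain ⟨r₃, hr₃, h3⟩ : ∃ r > 0, ∀ e, ∀ t ∈ Icc 0 (K.len e), dist x (K.map e t) < r →
      x ∈ K.map e '' Icc 0 (K.len e) := by
    have : ∀ e, ∃ r > 0, ∀ t ∈ Icc 0 (K.len e), dist x (K.map e t) < r →
        x ∈ K.map e '' Icc 0 (K.len e) := by
      intro e
      by_cases hxe : x ∈ K.map e '' Icc 0 (K.len e)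
      · exact ⟨1, one_pos, fun _ _ _ => hxe⟩
      · obtain ⟨r, hr, h⟩ := Metric.isOpen_iff.1 (K.isClosed_image e).isOpen_compl x hxe
        refine ⟨r, hr, fun t ht hd => ?_⟩
        exact absurd ⟨t, ht, rfl⟩
          (h (by rwa [Metric.mem_ball, dist_comm] : K.map e t ∈ Metric.ball x r))
    choose r hr h using this
    obtain ⟨ρ, hρ, hρ'⟩ := exists_pos_le_of_finite r hr
    exact ⟨ρ, hρ, fun e t ht hd => h e t ht (hd.trans_le (hρ' e))⟩
  set r := min r₁ (min r₂ r₃) with hr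
  have hr0 : 0 < r := lt_min hr₁ (lt_min hr₂ hr₃)
  have hrδ : ∀ ζ, r ≤ δ ζ := fun ζ => (min_le_left _ _).trans (h1 ζ)
  have hval : ∀ ζ, ∀ s ∈ Ico 0 (δ ζ), t₀ ζ + σ ζ * s ∈ Icc 0 (K.len (e ζ)) ∧
      dirPath ζ s = K.map (e ζ) (t₀ ζ + σ ζ * s) := by
    intro ζ s hs
    rcases hs.1.eq_or_lt with h0 | h0
    · rw [← h0, dirPath_zero, mul_zero, add_zero]
      exact ⟨ht ζ, (hx ζ).symm⟩
    · exact ⟨Ioo_subset_Icc_self (hγ ζ s ⟨h0, hs.2⟩).1, (hγ ζ s ⟨h0, hs.2⟩).2⟩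
  refine ⟨r, hr0, ?_, ?_, ?_, ?_, ?_⟩
  · intro ζ
    refine ⟨dirPath_zero ζ, fun s hs t ht' => ?_⟩
    have hs' : s ∈ Ico 0 (δ ζ) := ⟨hs.1, hs.2.trans_le (hrδ ζ)⟩
    have ht' : t ∈ Ico 0 (δ ζ) := ⟨ht'.1, ht'.2.trans_le (hrδ ζ)⟩
    rw [(hval ζ s hs').2, (hval ζ t ht').2, K.isom _ _ (hval ζ s hs').1 _ (hval ζ t ht').1]
    rcases hσ ζ with h | h <;> rw [h]
    · congr 1; ring
    · rw [abs_sub_comm s t]; congr 1; ring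
  · intro ζ t ht'
    have h := hγ ζ t ⟨ht'.1, ht'.2.trans_le (hrδ ζ)⟩
    rw [h.2]
    exact K.map_notMem h.1
  · intro ζ t ht' f hf
    have htδ : t < δ ζ := ht'.2.trans_le (hrδ ζ)
    have h := hγ ζ t ⟨ht'.1, htδ⟩
    obtain ⟨L, R, hLR, η, hη, hs⟩ := K.exists_slopes hf h.1
    have hmin : 0 < min η (min t (δ ζ - t)) := lt_min hη (lt_min ht'.1 (by linarith))
    have hb : ∀ s ∈ Ico 0 (min η (min t (δ ζ - t))), s ∈ Ico 0 η ∧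
        dirPath ζ (t + s) = K.map (e ζ) (t₀ ζ + σ ζ * t + σ ζ * s) ∧
        dirPath ζ (t - s) = K.map (e ζ) (t₀ ζ + σ ζ * t - σ ζ * s) := by
      intro s hs
      have b0 := hs.2.trans_le (min_le_left _ _)
      have b1 := hs.2.trans_le ((min_le_right _ _).trans (min_le_left _ _))
      have b2 := hs.2.trans_le ((min_le_right _ _).trans (min_le_right _ _))
      refine ⟨⟨hs.1, b0⟩, ?_, ?_⟩
      · rw [(hval ζ (t + s) ⟨by linarith [hs.1, ht'.1], by linarith⟩).2]
        congr 1; ring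
      · rw [(hval ζ (t - s) ⟨by linarith [hs.1, ht'.1], by linarith [hs.1]⟩).2]
        congr 1; ring
    rcases hσ ζ with h' | h'
    · refine ⟨L, R, by rw [h.2, hLR], _, hmin, fun s hs' => ?_⟩
      obtain ⟨hb0, hb1, hb2⟩ := hb s hs'
      rw [hb1, hb2, h.2]
      have := hs s hb0
      rw [h', one_mul s] at *
      exact this
    · refine ⟨R, L, by rw [h.2, hLR, add_comm], _, hmin, fun s hs' => ?_⟩
      obtain ⟨hb0, hb1, hb2⟩ := hb s hs'
      rw [hb1, hb2, h.2]
      have := hs s hb0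
      rw [h', neg_one_mul s, sub_neg_eq_add, ← sub_eq_add_neg] at *
      exact this.symm
  · intro y hy hyx
    have hyV : y ∉ V := fun h => hyx
      (h2 y h (hy.trans_le ((min_le_right _ _).trans (min_le_left _ _))))
    obtain ⟨e', t, htI, rfl⟩ := K.exists_map_eq hyV
    obtain ⟨t', ht', rfl⟩ := h3 e' t (Ioo_subset_Icc_self htI)
      (hy.trans_le ((min_le_right _ _).trans (min_le_right _ _)))
    have hd := K.isom e' t' ht' t (Ioo_subset_Icc_self htI)
    set d := dist (K.map e' t') (K.map e' t) with hdd
    have hd0 : 0 < d := dist_pos.2 (Ne.symm hyx)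
    obtain ⟨τ, hτ, hτd⟩ : ∃ τ : ℝ, (τ = 1 ∨ τ = -1) ∧ t = t' + τ * d := by
      rcases le_total t' t with hle | hle
      · refine ⟨1, Or.inl rfl, ?_⟩
        rw [hd, abs_of_nonpos (by linarith)]; ring
      · refine ⟨-1, Or.inr rfl, ?_⟩
        rw [hd, abs_of_nonneg (by linarith)]; ring
    have hI : ∀ s ∈ Ico 0 d, t' + τ * s ∈ Icc 0 (K.len e') := by
      intro s hs
      have h4 := htI.1
      have h5 := htI.2
      rw [hτd] at h4 h5
      rcases hτ with rfl | rfl <;> constructor <;> linarith [ht'.1, ht'.2, hs.1, hs.2]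
    let ζ : TangentDir (K.map e' t') := germ _ ⟨d, hd0, K.isUnitSpeedFrom_map hτ hI⟩
    obtain ⟨κ, hκ, hκ'⟩ : ∃ κ > 0, ∀ s ∈ Ico 0 κ, dirPath ζ s = K.map e' (t' + τ * s) :=
      dirPath_germ _
    set s := min (min κ d) (δ ζ) / 2 with hs
    have hs0 : 0 < min (min κ d) (δ ζ) := lt_min (lt_min hκ hd0) (hδ ζ)
    have a1 := (min_le_left (min κ d) (δ ζ)).trans (min_le_left _ _)
    have a2 := (min_le_left (min κ d) (δ ζ)).trans (min_le_right _ _)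
    have a3 := min_le_right (min κ d) (δ ζ)
    have h6 := hγ ζ s ⟨by linarith, by linarith⟩
    obtain ⟨he, htt, hσσ⟩ := K.eq_of_map_eq (ht ζ) ht' (by linarith : 0 < s) h6.1
      (hI s ⟨by linarith, by linarith⟩) (hx ζ)
      (by rw [← h6.2, hκ' s ⟨by linarith, by linarith⟩])
    refine ⟨ζ, ?_⟩
    rw [(hval ζ d ⟨hd0.le, hy.trans_le (hrδ ζ)⟩).2, he, htt, hσσ, ← hτd]
  · intro ζ η t ht' heq
    have a1 := hγ ζ t ⟨ht'.1, ht'.2.trans_le (hrδ ζ)⟩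
    have a2 := hγ η t ⟨ht'.1, ht'.2.trans_le (hrδ η)⟩
    obtain ⟨he, htt, hσσ⟩ := K.eq_of_map_eq (ht ζ) (ht η) ht'.1 a1.1
      (Ioo_subset_Icc_self a2.1) ((hx ζ).trans (hx η).symm) (by rw [← a1.2, heq, a2.2])
    refine tangentDir_ext hr0 fun s hs => ?_
    rw [(hval ζ s ⟨hs.1, hs.2.trans_le (hrδ ζ)⟩).2, (hval η s ⟨hs.1, hs.2.trans_le (hrδ η)⟩).2,
      he, htt, hσσ]

/-- A piecewise linear function on an interval whose slope never drops lies above its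
initial tangent. -/
theorem le_of_slopes_add_nonneg {F : ℝ → ℝ} {r k : ℝ} (hF : ContinuousOn F (Ico 0 r))
    (hk : ∃ δ > 0, ∀ s ∈ Ico 0 δ, F s = F 0 + k * s)
    (h : ∀ t ∈ Ioo 0 r, ∃ L R : ℝ, 0 ≤ L + R ∧ ∃ δ > 0, ∀ s ∈ Ico 0 δ,
      F (t + s) = F t + R * s ∧ F (t - s) = F t + L * s) {t : ℝ} (ht : t ∈ Ico 0 r) :
    F 0 + k * t ≤ F t := by
  by_contra! hlt
  obtain ⟨δ, hδ, hk⟩ := hk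
  have ht0 : 0 < t := by
    rcases ht.1.eq_or_lt with h0 | h0
    · rw [← h0] at hlt; simp at hlt
    · exact h0
  set m := (F t - F 0) / t with hm
  have hmk : m < k := by rw [hm, div_lt_iff₀ ht0]; linarith
  have hmt : m * t = F t - F 0 := by rw [hm]; field_simp
  set H : ℝ → ℝ := fun s => F s - F 0 - m * s with hH
  have hHc : ContinuousOn H (Icc 0 t) := by
    have : ContinuousOn F (Icc 0 t) := hF.mono fun s hs => ⟨hs.1, hs.2.trans_lt ht.2⟩
    exact (this.sub continuousOn_const).sub (by fun_prop)
  obtain ⟨p, hp, hpmax⟩ := isCompact_Icc.exists_isMaxOn (nonempty_Icc.2 ht0.le) hHc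
  have hpos : 0 < H p := by
    set s := min δ t / 2 with hs
    have hs0 : 0 < min δ t := lt_min hδ ht0
    have b1 := min_le_left δ t
    have b2 := min_le_right δ t
    have h1 : H s ≤ H p := hpmax (⟨by linarith, by linarith⟩ : s ∈ Icc 0 t)
    have h2 : H s = (k - m) * s := by
      simp only [hH, hk s ⟨by linarith, by linarith⟩]; ring
    have h3 : 0 < (k - m) * s := mul_pos (by linarith) (by linarith)
    linarith
  have hclosed : IsClosed (Icc 0 t ∩ H ⁻¹' {H p}) :=
    hHc.preimage_isClosed_of_isClosed isClosed_Icc isClosed_singleton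
  have hcpt : IsCompact (Icc 0 t ∩ H ⁻¹' {H p}) :=
    isCompact_Icc.of_isClosed_subset hclosed inter_subset_left
  obtain ⟨q, hq, hqmin⟩ := hcpt.exists_isLeast ⟨p, hp, rfl⟩
  have hHq : H q = H p := hq.2
  have hq0 : 0 < q := by
    refine lt_of_le_of_ne hq.1.1 ?_
    rintro rfl
    simp [hH] at hHq hpos
    linarith
  have hqt : q < t := by
    refine lt_of_le_of_ne hq.1.2 ?_
    rintro rfl
    have : H q = 0 := by simp only [hH, hmt]; ring
    linarith
  obtain ⟨L, R, hLR, η, hη, hs⟩ := h q ⟨hq0, hqt.trans ht.2⟩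
  set s := min η (min q (t - q)) / 2 with hsdef
  have hs0 : 0 < min η (min q (t - q)) := lt_min hη (lt_min hq0 (by linarith))
  have b1 := min_le_left η (min q (t - q))
  have b2 := (min_le_right η (min q (t - q))).trans (min_le_left _ _)
  have b3 := (min_le_right η (min q (t - q))).trans (min_le_right _ _)
  obtain ⟨c1, c2⟩ := hs s ⟨by linarith, by linarith⟩
  have m1 : H (q + s) ≤ H p := hpmax (⟨by linarith, by linarith⟩ : q + s ∈ Icc 0 t)
  have m2 : H (q - s) ≤ H p := hpmax (⟨by linarith, by linarith⟩ : q - s ∈ Icc 0 t)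
  have h5 : H (q - s) ≠ H p := by
    intro h5
    have := hqmin (⟨⟨by linarith, by linarith⟩, h5⟩ : q - s ∈ Icc 0 t ∩ H ⁻¹' {H p})
    linarith
  have m3 := lt_of_le_of_ne m2 h5
  rw [← hHq] at m1 m3
  simp only [hH, c1, c2] at m1 m3
  have : 0 ≤ (L + R) * s := mul_nonneg hLR (by linarith)
  nlinarith

/-- On a star, a function whose order is nonnegative along a branch lies above its
initial tangent. -/
theorem StarRadius.le_of_ordAt_nonneg {V : Set G} {x : G} {r : ℝ} (hr : StarRadius V x r)
    {f : G → ℝ} (hf : IsRational f) (ζ : TangentDir x)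
    (h : ∀ t ∈ Ioo 0 r, 0 ≤ ordAt f (dirPath ζ t)) {t : ℝ} (ht : t ∈ Ico 0 r) :
    f x + tangentSlope f ζ * t ≤ f (dirPath ζ t) := by
  have h1 := hf.hasSlopeAlong ζ
  have h2 := le_of_slopes_add_nonneg (F := fun s => f (dirPath ζ s)) (r := r)
    (k := tangentSlope f ζ) (hf.1.comp_continuousOn (hr.unitSpeed ζ).continuousOn) h1
    (fun t ht => ?_) ht
  · simpa only [dirPath_zero] using h2
  · obtain ⟨L, R, hLR, hs⟩ := hr.slopes ζ t ht f hf
    exact ⟨L, R, by exact_mod_cast hLR ▸ h t ht, hs⟩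

/-! ### Local linearity and finiteness -/

theorem exists_starRadius_linear {V : Set G} (K : EdgeAtlas V) {f : G → ℝ} (hf : IsRational f)
    (x : G) : ∃ r, StarRadius V x r ∧ ∀ ζ : TangentDir x, ∀ s ∈ Ico 0 r,
      f (dirPath ζ s) = f x + tangentSlope f ζ * s := by
  have := K.finite_tangentDir x
  obtain ⟨r, hr⟩ := exists_starRadius K x
  choose δ hδ h using fun ζ : TangentDir x => hf.hasSlopeAlong ζ
  obtain ⟨ρ, hρ, hρ'⟩ := exists_pos_le_of_finite δ hδ
  refine ⟨min r ρ, hr.mono (lt_min hr.pos hρ) (min_le_left _ _), fun ζ s hs => ?_⟩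
  rw [h ζ s ⟨hs.1, hs.2.trans_le ((min_le_right _ _).trans (hρ' ζ))⟩, dirPath_zero]

/-- If `f` is linear along a branch then its order vanishes there. -/
theorem StarRadius.ordAt_eq_zero {V : Set G} {x : G} {r : ℝ} (hr : StarRadius V x r)
    {f : G → ℝ} (hf : IsRational f) {ζ : TangentDir x} {a b c k : ℝ} (ha : 0 ≤ a) (hb : b ≤ r)
    (h : ∀ s ∈ Ioo a b, f (dirPath ζ s) = c + k * s) {t : ℝ} (ht : t ∈ Ioo a b) :
    ordAt f (dirPath ζ t) = 0 := by
  obtain ⟨L, R, hLR, δ, hδ, hs⟩ := hr.slopes ζ t ⟨ha.trans_lt ht.1, ht.2.trans_le hb⟩ f hf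
  set s := min δ (min (t - a) (b - t)) / 2 with hsdef
  have hs0 : 0 < min δ (min (t - a) (b - t)) :=
    lt_min hδ (lt_min (by linarith [ht.1]) (by linarith [ht.2]))
  have b1 := min_le_left δ (min (t - a) (b - t))
  have b2 := (min_le_right δ (min (t - a) (b - t))).trans (min_le_left _ _)
  have b3 := (min_le_right δ (min (t - a) (b - t))).trans (min_le_right _ _)
  obtain ⟨c1, c2⟩ := hs s ⟨by linarith, by linarith⟩
  rw [h _ ⟨by linarith, by linarith⟩, h _ ht] at c1 c2
  have : ((L + R : ℤ) : ℝ) * s = 0 * s := by push_cast; linarith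
  rw [hLR]
  exact_mod_cast mul_right_cancel₀ (by linarith : s ≠ 0) this

theorem exists_ordAt_eq_zero {V : Set G} (K : EdgeAtlas V) {f : G → ℝ} (hf : IsRational f)
    (x : G) : ∃ r > 0, ∀ y, dist x y < r → y ≠ x → ordAt f y = 0 := by
  obtain ⟨r, hr, h⟩ := exists_starRadius_linear K hf x
  refine ⟨r, hr.pos, fun y hy hne => ?_⟩
  obtain ⟨ζ, hζ⟩ := hr.cover y hy hne
  rw [← hζ]
  exact hr.ordAt_eq_zero hf le_rfl le_rfl (fun s hs => h ζ s (Ioo_subset_Ico_self hs))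
    ⟨dist_pos.2 hne.symm, hy⟩

theorem finite_support_ordAt [CompactSpace G] {V : Set G} (K : EdgeAtlas V) {f : G → ℝ}
    (hf : IsRational f) : FinSupp (ordAt f) := by
  choose r hr h using exists_ordAt_eq_zero K hf
  obtain ⟨t, ht⟩ := isCompact_univ.elim_nhds_subcover (fun x => Metric.ball x (r x))
    (fun x _ => Metric.ball_mem_nhds x (hr x))
  refine t.finite_toSet.subset fun y hy => ?_
  obtain ⟨x, hx, hxy⟩ := mem_iUnion₂.1 (ht.2 (mem_univ y))
  by_contra hne
  refine hy (h x y (by rwa [dist_comm]) ?_)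
  rintro rfl
  exact hne hx

theorem eq_on_ball_of_tangentSlope_eq_zero {V : Set G} (K : EdgeAtlas V) {f : G → ℝ}
    (hf : IsRational f) {x : G} (h0 : ∀ ζ : TangentDir x, tangentSlope f ζ = 0) :
    ∃ r > 0, ∀ y, dist x y < r → f y = f x := by
  obtain ⟨r, hr, h⟩ := exists_starRadius_linear K hf x
  refine ⟨r, hr.pos, fun y hy => ?_⟩
  by_cases hne : y = x
  · rw [hne]
  obtain ⟨ζ, hζ⟩ := hr.cover y hy hne
  rw [← hζ, h ζ _ ⟨dist_nonneg, hy⟩, h0]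
  simp

theorem ordAt_eq_zero_of_tangentSlope {f : G → ℝ} {x : G}
    (h0 : ∀ ζ : TangentDir x, tangentSlope f ζ = 0) : ordAt f x = 0 := by
  simp [ordAt, h0]

/-- The complement of a finite set has finitely many components. -/
theorem finite_compsOf_compl [CompactSpace G] {V : Set G} (K : EdgeAtlas V) {S : Set G}
    (hS : S.Finite) : (compsOf Sᶜ).Finite := by
  have key : ∀ x : G, ∃ r > 0, {C | C ∈ compsOf Sᶜ ∧ (C ∩ Metric.ball x r).Nonempty}.Finite := by
    intro x
    have := K.finite_tangentDir x
    obtain ⟨r, hr⟩ := exists_starRadius K x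
    obtain ⟨ρ, hρ, hρS⟩ : ∃ ρ > 0, ∀ y ∈ S, dist x y < ρ → y = x := by
      have hc : IsClosed (S \ {x}) := (hS.subset sdiff_subset).isClosed
      obtain ⟨r, hr, h⟩ := Metric.isOpen_iff.1 hc.isOpen_compl x (by simp)
      refine ⟨r, hr, fun y hy hd => ?_⟩
      by_contra hne
      exact h (by rwa [Metric.mem_ball, dist_comm] : y ∈ Metric.ball x r) ⟨hy, hne⟩
    have hm := hr.mono (lt_min hr.pos hρ) (min_le_left _ _)
    refine ⟨min r ρ, hm.pos, ?_⟩
    set m := min r ρ with hmdef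
    have hout : ∀ ζ : TangentDir x, ∀ t ∈ Ioo 0 m, dirPath ζ t ∈ Sᶜ := by
      intro ζ t ht hmem
      have hd := hm.dist_dirPath ζ (Ioo_subset_Ico_self ht)
      have := hρS _ hmem (by rw [hd]; exact ht.2.trans_le (min_le_right _ _))
      rw [this, dist_self] at hd
      exact ht.1.ne hd
    refine ((finite_range fun ζ : TangentDir x =>
      connectedComponentIn Sᶜ (dirPath ζ (m/2))).union
        (finite_singleton (connectedComponentIn Sᶜ x))).subset ?_
    rintro C ⟨hC, y, hyC, hy⟩
    have hCy : C = connectedComponentIn Sᶜ y :=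
      eq_of_mem_compsOf hC (connectedComponentIn_mem_compsOf (subset_of_mem_compsOf hC hyC)) hyC
        (mem_connectedComponentIn (subset_of_mem_compsOf hC hyC))
    by_cases hne : y = x
    · right
      rw [hCy, hne]; rfl
    left
    rw [Metric.mem_ball, dist_comm] at hy
    obtain ⟨ζ, hζ⟩ := hm.cover y hy hne
    refine ⟨ζ, ?_⟩
    simp only
    rw [hCy]
    have hpc : IsPreconnected (dirPath ζ '' Ioo 0 m) :=
      isPreconnected_Ioo.image _ ((hm.unitSpeed ζ).continuousOn.mono Ioo_subset_Ico_self)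
    have hmid : m/2 ∈ Ioo 0 m := ⟨by linarith [hm.pos], by linarith [hm.pos]⟩
    have hsub := hpc.subset_connectedComponentIn (F := Sᶜ) (mem_image_of_mem _ hmid)
      (by rintro _ ⟨t, ht, rfl⟩; exact hout ζ t ht)
    exact connectedComponentIn_eq (hsub ⟨dist x y, ⟨dist_pos.2 (Ne.symm hne), hy⟩, hζ⟩)
  choose r hr h using key
  obtain ⟨t, ht⟩ := isCompact_univ.elim_nhds_subcover (fun x => Metric.ball x (r x))
    (fun x _ => Metric.ball_mem_nhds x (hr x))
  refine (t.finite_toSet.biUnion fun x _ => h x).subset fun C hC => ?_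
  obtain ⟨y, hy, rfl⟩ := id hC
  obtain ⟨x, hx, hxy⟩ := mem_iUnion₂.1 (ht.2 (mem_univ y))
  exact mem_biUnion hx ⟨hC, y, mem_connectedComponentIn hy, hxy⟩

/-! ### The metric on a linear system -/

section Osc

variable [CompactSpace G] [Nonempty G] {f g : G → ℝ}

theorem sub_le_osc (hf : Continuous f) (x y : G) : f x - f y ≤ osc f := by
  have hb := isCompact_range hf
  exact sub_le_sub (le_csSup hb.bddAbove ⟨x, rfl⟩) (csInf_le hb.bddBelow ⟨y, rfl⟩)

theorem osc_nonneg (hf : Continuous f) : 0 ≤ osc f := by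
  obtain ⟨x⟩ := ‹Nonempty G›
  simpa using sub_le_osc hf x x

theorem osc_le {c : ℝ} (h : ∀ x y, f x - f y ≤ c) : osc f ≤ c := by
  have h1 : sSup (range f) ≤ c + sInf (range f) := by
    refine csSup_le (range_nonempty f) ?_
    rintro _ ⟨x, rfl⟩
    have : f x - c ≤ sInf (range f) := by
      refine le_csInf (range_nonempty f) ?_
      rintro _ ⟨y, rfl⟩
      linarith [h x y]
    linarith
  unfold osc
  linarith

theorem linDist_le {D₁ D₂ : G → ℤ} (hf : IsRational f) (h : ∀ x, D₂ x = D₁ x + ordAt f x) :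
    linDist D₁ D₂ ≤ osc f := by
  refine csInf_le ⟨0, ?_⟩ ⟨f, hf, h, rfl⟩
  rintro _ ⟨g, hg, -, rfl⟩
  exact osc_nonneg hg.1

theorem exists_of_linDist_lt {D₁ D₂ : G → ℤ} (h : LinEquiv D₁ D₂) {c : ℝ}
    (hc : linDist D₁ D₂ < c) :
    ∃ f : G → ℝ, IsRational f ∧ (∀ x, D₂ x = D₁ x + ordAt f x) ∧ osc f < c := by
  obtain ⟨f, hf, hfD⟩ := h
  obtain ⟨_, ⟨g, hg, hgD, rfl⟩, hlt⟩ := exists_lt_of_csInf_lt (s := {r : ℝ | ∃ f : G → ℝ,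
    IsRational f ∧ (∀ x, D₂ x = D₁ x + ordAt f x) ∧ r = osc f}) ⟨_, f, hf, hfD, rfl⟩ hc
  exact ⟨g, hg, hgD, hlt⟩

theorem linDist_triangle [∀ x : G, Finite (TangentDir x)] {D₁ D₂ D₃ : G → ℤ}
    (h₁ : LinEquiv D₁ D₂) (h₂ : LinEquiv D₂ D₃) :
    linDist D₁ D₃ ≤ linDist D₁ D₂ + linDist D₂ D₃ := by
  apply le_of_forall_pos_le_add
  intro ε hε
  obtain ⟨f, hf, hfD, hfo⟩ := exists_of_linDist_lt h₁ (lt_add_of_pos_right _ (half_pos hε))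
  obtain ⟨g, hg, hgD, hgo⟩ := exists_of_linDist_lt h₂ (lt_add_of_pos_right _ (half_pos hε))
  have h3 : linDist D₁ D₃ ≤ osc (fun x => f x + g x) := linDist_le (hf.add hg) fun x => by
    rw [ordAt_add hf hg, hgD, hfD, add_assoc]
  have h4 : osc (fun x => f x + g x) ≤ osc f + osc g := osc_le fun x y => by
    linarith [sub_le_osc hf.1 x y, sub_le_osc hg.1 x y]
  linarith

theorem linDist_self (D : G → ℤ) : linDist D D = 0 := by
  have h : osc (fun _ : G => (0:ℝ)) ≤ 0 := osc_le fun x y => by simp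
  refine le_antisymm ((linDist_le (isRational_const 0) fun x => ?_).trans h) ?_
  · rw [ordAt_const, add_zero]
  · refine le_csInf ⟨_, _, isRational_const 0, fun x => by rw [ordAt_const, add_zero], rfl⟩ ?_
    rintro _ ⟨g, hg, -, rfl⟩
    exact osc_nonneg hg.1

end Osc

theorem LinEquiv.symm {D₁ D₂ : G → ℤ} (h : LinEquiv D₁ D₂) : LinEquiv D₂ D₁ := by
  obtain ⟨f, hf, hfD⟩ := h
  exact ⟨_, hf.neg, fun x => by rw [ordAt_neg hf, hfD]; ring⟩

theorem LinEquiv.trans [∀ x : G, Finite (TangentDir x)] {D₁ D₂ D₃ : G → ℤ}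
    (h₁ : LinEquiv D₁ D₂) (h₂ : LinEquiv D₂ D₃) : LinEquiv D₁ D₃ := by
  obtain ⟨f, hf, hfD⟩ := h₁
  obtain ⟨g, hg, hgD⟩ := h₂
  exact ⟨_, hf.add hg, fun x => by rw [ordAt_add hf hg, hgD, hfD, add_assoc]⟩

/-! ### Semicontinuity of the number of chips on the edges -/

theorem exists_pos_separated {S : Set G} (hS : S.Finite) :
    ∃ r > 0, ∀ x ∈ S, ∀ y ∈ S, x ≠ y → 2 * r ≤ dist x y := by
  have := hS.to_subtype
  obtain ⟨r, hr, h⟩ := exists_pos_le_of_finite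
    (fun p : {p : S × S // p.1 ≠ p.2} => dist p.1.1 p.1.2) (fun p => dist_pos.2 p.2)
  refine ⟨r / 2, half_pos hr, fun x hx y hy hne => ?_⟩
  have := h ⟨(⟨x, hx⟩, ⟨y, hy⟩), by simpa using hne⟩
  simp only [Subtype.dist_eq] at this
  linarith

theorem eq_of_dist_lt {S : Set G} {r : ℝ} (h : ∀ x ∈ S, ∀ y ∈ S, x ≠ y → 2 * r ≤ dist x y)
    {x y z : G} (hx : x ∈ S) (hy : y ∈ S) (hxz : dist x z < r) (hyz : dist y z < r) : x = y := by
  by_contra hne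
  linarith [h x hx y hy hne, dist_triangle_right x y z]

theorem exists_edgeSupp_near [CompactSpace G] [Nonempty G] {V : Set G} (K : EdgeAtlas V)
    {D : G → ℤ} (hD : Effective D) {x : G} (hx : x ∈ edgeSupp V D) {r : ℝ} (hr : 0 < r) :
    ∃ δ > 0, ∀ (g : G → ℝ) (D' : G → ℤ), IsRational g → (∀ x, D' x = D x + ordAt g x) →
      osc g < δ → ∃ y ∈ edgeSupp V D', dist x y < r := by
  have := K.finite_tangentDir x
  obtain ⟨ρ, hρ⟩ := exists_starRadius K x
  have hm := hρ.mono (lt_min hρ.pos hr) (min_le_left _ _)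
  set m := min ρ r
  refine ⟨m / 2, half_pos hm.pos, fun g D' hg hgD hosc => ?_⟩
  by_contra! hno
  have hmr : m ≤ r := min_le_right _ _
  have hx0 : D' x = 0 := by
    by_contra h
    have := hno x ⟨hx.1, h⟩
    rw [dist_self] at this
    linarith
  have hb0 : ∀ ζ : TangentDir x, ∀ t ∈ Ioo 0 m, D' (dirPath ζ t) = 0 := by
    intro ζ t ht
    by_contra h
    have := hno _ ⟨hm.notMem ζ t ht, h⟩
    rw [hm.dist_dirPath ζ (Ioo_subset_Ico_self ht)] at this
    linarith [ht.2]
  have hDx : 1 ≤ D x := Int.add_one_le_iff.2 (lt_of_le_of_ne (hD x) (Ne.symm hx.2))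
  obtain ⟨ζ, hζ⟩ : ∃ ζ : TangentDir x, tangentSlope g ζ ≤ -1 := by
    by_contra! hall
    have h0 : 0 ≤ ordAt g x := finsum_nonneg fun ζ => by linarith [hall ζ]
    linarith [hgD x]
  have h1 := hm.le_of_ordAt_nonneg hg.neg ζ (fun t ht => by
    rw [ordAt_neg hg]
    linarith [hgD (dirPath ζ t), hb0 ζ t ht, hD (dirPath ζ t)])
    (⟨by linarith [hm.pos], by linarith [hm.pos]⟩ : m / 2 ∈ Ico 0 m)
  rw [hg.tangentSlope_neg] at h1
  have h2 : (1:ℝ) ≤ ((-tangentSlope g ζ : ℤ) : ℝ) := by exact_mod_cast (by linarith)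
  have h3 := sub_le_osc hg.1 x (dirPath ζ (m/2))
  nlinarith [hm.pos]

theorem exists_ncard_edgeSupp_le [CompactSpace G] [Nonempty G] {V : Set G} (K : EdgeAtlas V)
    {D₀ D : G → ℤ} (hD : D ∈ LinSys D₀) :
    ∃ δ > 0, ∀ D' ∈ LinSys D₀, linDist D D' < δ →
      (edgeSupp V D).ncard ≤ (edgeSupp V D').ncard := by
  have hfin := K.finite_tangentDir
  have hS : (edgeSupp V D).Finite := hD.1.subset fun x hx => hx.2
  have := hS.to_subtype
  obtain ⟨r, hr, hsep⟩ := exists_pos_separated hS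
  choose δ hδ h using fun x : edgeSupp V D => exists_edgeSupp_near K hD.2.1 x.2 hr
  obtain ⟨ε, hε, hε'⟩ := exists_pos_le_of_finite δ hδ
  refine ⟨ε, hε, fun D' hD' hd => ?_⟩
  obtain ⟨g, hg, hgD, hosc⟩ := exists_of_linDist_lt (hD.2.2.symm.trans hD'.2.2) hd
  choose y hy hxy using fun x => h x g D' hg hgD (hosc.trans_le (hε' x))
  have hinj : Injective y := fun a b hab =>
    Subtype.ext (eq_of_dist_lt hsep a.2 b.2 (hxy a) (hab ▸ hxy b))
  have hS' : (edgeSupp V D').Finite := hD'.1.subset fun x hx => hx.2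
  rw [← Nat.card_coe_set_eq, ← Nat.card_coe_set_eq]
  have := hS'.to_subtype
  exact Nat.card_le_card_of_injective (fun x => ⟨y x, hy x⟩) fun a b hab =>
    hinj (Subtype.ext_iff.1 hab)

/-! ### Existence of tangent directions -/

theorem IsStarNbhdOf.nontrivial {x : G} {v : ℕ} {U : Set G} (h : IsStarNbhdOf x v U) :
    Nontrivial G := by
  obtain ⟨ε, hε, φ, hx, -⟩ := h
  by_contra hn
  rw [not_nontrivial_iff_subsingleton] at hn
  obtain ⟨⟨i, -⟩, -⟩ := Quotient.exists_rep (φ ⟨x, hx⟩)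
  have h1 : (Quotient.mk (starSetoid v ε) (i, ⟨0, le_rfl, hε⟩) : StarGlue v ε) =
      Quotient.mk (starSetoid v ε) (i, ⟨ε / 2, by constructor <;> linarith⟩) :=
    φ.symm.injective (Subsingleton.elim _ _)
  rcases Quotient.exact h1 with h2 | h2
  · have := congrArg (fun a => ((a : Fin v × Ico (0:ℝ) ε).2 : ℝ)) h2
    simp only at this
    linarith
  · have := h2.2
    simp only at this
    linarith

theorem nonempty_tangentDir [ConnectedSpace G] [Nontrivial G] {V : Set G} (K : EdgeAtlas V)
    (x : G) : Nonempty (TangentDir x) := by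
  by_contra hn
  obtain ⟨r, hr⟩ := exists_starRadius K x
  have hb : Metric.ball x r = {x} := by
    ext y
    refine ⟨fun hy => ?_, fun hy => by rw [hy]; exact Metric.mem_ball_self hr.pos⟩
    by_contra hne
    obtain ⟨ζ, -⟩ := hr.cover y (by rwa [dist_comm]) hne
    exact hn ⟨ζ⟩
  have ho : IsOpen ({x} : Set G) := hb ▸ Metric.isOpen_ball
  have hu := IsClopen.eq_univ ⟨isClosed_singleton, ho⟩ (singleton_nonempty x)
  obtain ⟨y, hy⟩ := exists_ne x
  exact hy (hu ▸ mem_univ y : y ∈ ({x} : Set G))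

theorem StarRadius.exists_notMem_finite {V : Set G} {x : G} {r : ℝ} (hr : StarRadius V x r)
    (ζ : TangentDir x) {T : Set G} (hT : T.Finite) : ∃ t ∈ Ioo 0 r, dirPath ζ t ∉ T := by
  by_contra! h
  have hinj : InjOn (dirPath ζ) (Ioo 0 r) :=
    (hr.unitSpeed ζ).injOn.mono Ioo_subset_Ico_self
  exact (Ioo_infinite hr.pos) ((hT.subset (image_subset_iff.2 h)).of_finite_image hinj)

theorem exists_mem_comp_notMem {V : Set G} (K : EdgeAtlas V) [∀ x : G, Nonempty (TangentDir x)]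
    {S T C : Set G} (hS : S.Finite) (hT : T.Finite) (hC : C ∈ compsOf Sᶜ) : ∃ p ∈ C, p ∉ T := by
  obtain ⟨x, hx, rfl⟩ := hC
  obtain ⟨r₁, hr₁⟩ := exists_starRadius K x
  obtain ⟨r₂, hr₂, h2⟩ := Metric.isOpen_iff.1 hS.isClosed.isOpen_compl x hx
  have hr := hr₁.mono (lt_min hr₁.pos hr₂) (min_le_left _ _)
  obtain ⟨ζ⟩ := ‹∀ x : G, Nonempty (TangentDir x)› x
  obtain ⟨t, ht, htT⟩ := hr.exists_notMem_finite ζ hT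
  refine ⟨_, ?_, htT⟩
  have hpre : IsPreconnected (dirPath ζ '' Ico 0 (min r₁ r₂)) :=
    isPreconnected_Ico.image _ (hr.unitSpeed ζ).continuousOn
  refine hpre.subset_connectedComponentIn ⟨0, ⟨le_rfl, hr.pos⟩, dirPath_zero ζ⟩ ?_
    ⟨t, Ioo_subset_Ico_self ht, rfl⟩
  rintro _ ⟨s, hs, rfl⟩
  apply h2
  rw [Metric.mem_ball, dist_comm, hr.dist_dirPath ζ hs]
  exact hs.2.trans_le (min_le_right _ _)

theorem exists_effective_of_finite [Nonempty G] {P : Set G} (hP : P.Finite) {d : ℕ}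
    (hd : P.ncard ≤ d) :
    ∃ E : G → ℤ, FinSupp E ∧ Effective E ∧ deg E = d ∧ ∀ p ∈ P, 1 ≤ E p := by
  classical
  let m : Multiset G := hP.toFinset.val + Multiset.replicate (d - P.ncard) (Classical.arbitrary G)
  have hsub : Function.support (fun x => (m.count x : ℤ)) ⊆ (m.toFinset : Set G) := by
    intro x hx
    simpa [Multiset.count_eq_zero] using hx
  refine ⟨fun x => (m.count x : ℤ), (Finset.finite_toSet _).subset hsub, fun x => by positivity,
    ?_, fun p hp => ?_⟩
  · rw [deg, finsum_eq_sum_of_support_subset _ hsub]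
    norm_cast
    rw [Multiset.toFinset_sum_count_eq, Multiset.card_add, Multiset.card_replicate,
      Finset.card_val, ← ncard_eq_toFinset_card P hP]
    omega
  · have : p ∈ m := Multiset.mem_add.2 (Or.inl (by simpa using hp))
    have := Multiset.one_le_count_iff_mem.2 this
    show (1:ℤ) ≤ (m.count p : ℤ)
    exact_mod_cast this

/-! ### Truncations of rational functions near their maximum -/

theorem tangentSlope_nonpos_of_isMax {f : G → ℝ} (hf : IsRational f) {x : G}
    (hx : ∀ y, f y ≤ f x) (ζ : TangentDir x) : tangentSlope f ζ ≤ 0 := by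
  obtain ⟨δ, hδ, h⟩ := hf.hasSlopeAlong ζ
  have h1 := h (δ / 2) ⟨by linarith, by linarith⟩
  have h2 := hx (dirPath ζ (δ / 2))
  rw [dirPath_zero] at h1
  have : (tangentSlope f ζ : ℝ) * (δ / 2) ≤ 0 := by linarith
  by_contra! hpos
  have : (0:ℝ) < tangentSlope f ζ := by exact_mod_cast hpos
  nlinarith

theorem tangentSlope_eq_zero_of_isMax {V : Set G} (K : EdgeAtlas V) {f : G → ℝ}
    (hf : IsRational f) {x : G} (hx : ∀ y, f y ≤ f x) (h0 : 0 ≤ ordAt f x) (ζ : TangentDir x) :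
    tangentSlope f ζ = 0 := by
  have := K.finite_tangentDir x
  have := Fintype.ofFinite (TangentDir x)
  rw [ordAt, finsum_eq_sum_of_fintype] at h0
  have hle : ∀ η ∈ Finset.univ, tangentSlope f (x := x) η ≤ 0 :=
    fun η _ => tangentSlope_nonpos_of_isMax hf hx η
  exact (Finset.sum_eq_zero_iff_of_nonpos hle).1
    (le_antisymm (Finset.sum_nonpos hle) h0) ζ (Finset.mem_univ _)

theorem LinSys.add_ordAt [CompactSpace G] {V : Set G} (K : EdgeAtlas V) {D₀ D : G → ℤ}
    (hD : D ∈ LinSys D₀) {f : G → ℝ} (hf : IsRational f) (h : ∀ x, 0 ≤ D x + ordAt f x) :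
    (fun x => D x + ordAt f x) ∈ LinSys D₀ := by
  have := K.finite_tangentDir
  refine ⟨?_, h, hD.2.2.trans ⟨f, hf, fun x => rfl⟩⟩
  refine (hD.1.union (finite_support_ordAt K hf)).subset ?_
  exact Function.support_add _ _

theorem add_ordAt_max_const_nonneg {V : Set G} (K : EdgeAtlas V) {D : G → ℤ} (hD : Effective D)
    {f : G → ℝ} (hf : IsRational f) (h : ∀ x, 0 ≤ D x + ordAt f x) (c : ℝ) (x : G) :
    0 ≤ D x + ordAt (fun y => max (f y) c) x := by
  have := K.finite_tangentDir x
  have := Fintype.ofFinite (TangentDir x)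
  by_cases hlt : c < f x
  · have : ordAt (fun y => max (f y) c) x = ordAt f x := by
      refine finsum_congr fun ζ => ?_
      rw [hf.tangentSlope_max_const, if_neg hlt.ne', if_neg hlt.not_gt]
    rw [this]; exact h x
  · have : 0 ≤ ordAt (fun y => max (f y) c) x := by
      rw [ordAt, finsum_eq_sum_of_fintype]
      refine Finset.sum_nonneg fun ζ _ => ?_
      rw [hf.tangentSlope_max_const]
      split_ifs with h1 h2
      · exact le_max_right _ _
      · exact le_rfl
      · exact absurd (lt_of_le_of_ne (not_lt.1 hlt) h1) h2
    have := hD x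
    omega

theorem osc_max_const_le [CompactSpace G] [Nonempty G] {f : G → ℝ} {M ε : ℝ} (hε : 0 ≤ ε)
    (hM : ∀ x, f x ≤ M) : osc (fun y => max (f y) (M - ε)) ≤ ε := by
  refine osc_le fun x y => ?_
  have h1 : max (f x) (M - ε) ≤ M := max_le (hM x) (by linarith)
  have h2 := le_max_right (f y) (M - ε)
  linarith

theorem exists_ordAt_max_const_pos {V : Set G} (K : EdgeAtlas V) {f : G → ℝ} (hf : IsRational f)
    {z : G} (ζ : TangentDir z) (hζ : tangentSlope f ζ < 0) {r : ℝ}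
    (hr : 0 < r) :
    ∃ ε₀ > 0, ∀ ε ∈ Ioo 0 ε₀, ∃ t ∈ Ioo 0 r, dirPath ζ t ∉ V ∧ dist z (dirPath ζ t) < r ∧
      0 < ordAt (fun y => max (f y) (f z - ε)) (dirPath ζ t) := by
  obtain ⟨r', hr', hlin⟩ := exists_starRadius_linear K hf z
  set s : ℝ := -(tangentSlope f ζ : ℝ) with hs
  have hs0 : 0 < s := by
    have : (tangentSlope f ζ : ℝ) < 0 := by exact_mod_cast hζ
    linarith
  have hlin' : ∀ u ∈ Ico 0 r', f (dirPath ζ u) = f z - s * u := fun u hu => by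
    rw [hlin ζ u hu, hs]; ring
  refine ⟨s * min r r', mul_pos hs0 (lt_min hr hr'.pos), fun ε hε => ?_⟩
  have ht0 : 0 < ε / s := div_pos hε.1 hs0
  have htm : ε / s < min r r' := (div_lt_iff₀' hs0).2 hε.2
  have htr : ε / s < r := htm.trans_le (min_le_left _ _)
  have htr' : ε / s < r' := htm.trans_le (min_le_right _ _)
  have hst : s * (ε / s) = ε := mul_div_cancel₀ _ hs0.ne'
  set t := ε / s
  refine ⟨t, ⟨ht0, htr⟩, hr'.notMem ζ t ⟨ht0, htr'⟩,
    by rwa [hr'.dist_dirPath ζ ⟨ht0.le, htr'⟩], ?_⟩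
  obtain ⟨L, R, hLR, δ, hδ, hsl⟩ := hr'.slopes ζ t ⟨ht0, htr'⟩ _ (hf.max_const (f z - ε))
  obtain ⟨u, hu0, hu⟩ : ∃ u > 0, u < min δ (min t (r' - t)) :=
    ⟨_, half_pos (lt_min hδ (lt_min ht0 (by linarith))),
      half_lt_self (lt_min hδ (lt_min ht0 (by linarith)))⟩
  rw [lt_min_iff, lt_min_iff] at hu
  obtain ⟨h1, h2⟩ := hsl u ⟨hu0.le, hu.1⟩
  rw [hlin' _ ⟨by linarith, by linarith⟩, hlin' t ⟨ht0.le, htr'⟩] at h1 h2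
  have hsu := mul_pos hs0 hu0
  rw [max_eq_right (by rw [mul_add]; linarith), max_eq_right (by linarith)] at h1
  rw [max_eq_left (by rw [mul_sub]; linarith), max_eq_right (by linarith)] at h2
  have hR : (R : ℝ) = 0 := by
    have : (R : ℝ) * u = 0 := by linarith
    exact (mul_eq_zero.1 this).resolve_right hu0.ne'
  have hL : (L : ℝ) = s := by
    have : (L : ℝ) * u = s * u := by rw [mul_sub] at h2; linarith
    exact mul_right_cancel₀ hu0.ne' this
  have : (0:ℝ) < (L + R : ℤ) := by push_cast; rw [hR, hL]; linarith
  rw [hLR]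
  exact_mod_cast this

theorem exists_edgeSupp_truncation_near {V : Set G} (K : EdgeAtlas V) {D : G → ℤ}
    (hD : Effective D) {f : G → ℝ} (hf : IsRational f) {M : ℝ} (hM : ∀ x, f x ≤ M) {p : G}
    (hp : p ∈ edgeSupp V D) {r : ℝ} (hr : 0 < r) :
    ∃ ε₀ > 0, ∀ ε ∈ Ioo 0 ε₀, ∃ y ∈ edgeSupp V
      (fun x => D x + ordAt (fun y => max (f y) (M - ε)) x), dist p y < r := by
  have hzero : ∀ ε, (∀ ζ : TangentDir p, tangentSlope (fun y => max (f y) (M - ε)) ζ = 0) →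
      ∃ y ∈ edgeSupp V (fun x => D x + ordAt (fun y => max (f y) (M - ε)) x), dist p y < r := by
    intro ε h
    refine ⟨p, ⟨hp.1, ?_⟩, by rwa [dist_self]⟩
    simp only
    rw [ordAt_eq_zero_of_tangentSlope h, add_zero]
    exact hp.2
  rcases (hM p).lt_or_eq with hlt | heq
  · refine ⟨M - f p, by linarith, fun ε hε => hzero ε fun ζ => ?_⟩
    have := hε.2
    rw [hf.tangentSlope_max_const, if_neg (by linarith), if_pos (by linarith)]
  · by_cases h0 : ∀ ζ : TangentDir p, tangentSlope f ζ = 0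
    · refine ⟨1, one_pos, fun ε hε => hzero ε fun ζ => ?_⟩
      have := hε.1
      rw [hf.tangentSlope_max_const, if_neg (by linarith), if_neg (by linarith), h0]
    · push Not at h0
      obtain ⟨ζ, hζ⟩ := h0
      have hneg : tangentSlope f ζ < 0 :=
        lt_of_le_of_ne (tangentSlope_nonpos_of_isMax hf (fun y => (hM y).trans heq.ge) ζ) hζ
      obtain ⟨ε₀, hε₀, h⟩ := exists_ordAt_max_const_pos K hf ζ hneg hr
      refine ⟨ε₀, hε₀, fun ε hε => ?_⟩
      obtain ⟨t, -, hV, hd, hpos⟩ := h ε hε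
      rw [heq] at hpos
      refine ⟨dirPath ζ t, ⟨hV, ?_⟩, hd⟩
      have := hD (dirPath ζ t)
      simp only
      omega

theorem ncard_add_le_of_near {T S B : Set G} {z : G} {r : ℝ} (hz : z ∉ T) (hS : S.Finite)
    (hT : T.Finite)
    (hsep : ∀ x ∈ insert z T, ∀ y ∈ insert z T, x ≠ y → 2 * r ≤ dist x y)
    (h : ∀ p ∈ T, ∃ y ∈ S, dist p y < r) (hB : ∀ b ∈ B, b ∈ S ∧ dist z b < r) :
    T.ncard + B.ncard ≤ S.ncard := by
  choose! y hyS hy using h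
  have hinj : InjOn y T := fun p hp q hq hpq =>
    eq_of_dist_lt hsep (mem_insert_of_mem _ hp) (mem_insert_of_mem _ hq) (hy p hp)
      (hpq ▸ hy q hq)
  have hdis : Disjoint (y '' T) B := by
    rw [Set.disjoint_left]
    rintro _ ⟨p, hp, rfl⟩ hb
    have := eq_of_dist_lt hsep (mem_insert_of_mem _ hp) (mem_insert _ _) (hy p hp) (hB _ hb).2
    exact hz (this ▸ hp)
  have hBf : B.Finite := hS.subset fun b hb => (hB b hb).1
  rw [← hinj.ncard_image, ← ncard_union_eq hdis (hT.image _) hBf]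
  refine ncard_le_ncard (union_subset ?_ fun b hb => (hB b hb).1) hS
  rintro _ ⟨p, hp, rfl⟩
  exact hyS p hp

/-- A divisor whose number of edge chips is maximal among nearby divisors of `|D₀|`. -/
def IsLocalMaxChips (V : Set G) (D₀ D : G → ℤ) : Prop :=
  ∃ ε > (0:ℝ), ∀ D' ∈ LinSys D₀, linDist D D' < ε → (edgeSupp V D').ncard ≤ (edgeSupp V D).ncard

section LocalMax

variable [CompactSpace G] [Nonempty G] {V : Set G} {D₀ D : G → ℤ} {f : G → ℝ} {M : ℝ}

theorem IsLocalMaxChips.ncard_le (K : EdgeAtlas V) (hloc : IsLocalMaxChips V D₀ D)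
    (hD : D ∈ LinSys D₀)
    (hf : IsRational f) (hfD : ∀ x, 0 ≤ D x + ordAt f x) (hM : ∀ x, f x ≤ M) {z : G}
    {n : ℕ}
    (hB : ∃ ρ > 0, ∀ r ∈ Ioo 0 ρ, ∃ ε₀ > 0, ∀ ε ∈ Ioo 0 ε₀, ∃ B : Set G, B.ncard = n ∧
      ∀ b ∈ B, b ∈ edgeSupp V (fun x => D x + ordAt (fun y => max (f y) (M - ε)) x) ∧
        dist z b < r) :
    (edgeSupp V D \ {z}).ncard + n ≤ (edgeSupp V D).ncard := by
  obtain ⟨η, hη, hloc⟩ := hloc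
  obtain ⟨ρ, hρ, hB⟩ := hB
  have hfin : (edgeSupp V D \ {z}).Finite :=
    (hD.1.subset fun x hx => hx.2).subset sdiff_subset
  obtain ⟨r₁, hr₁, hsep⟩ := exists_pos_separated (hfin.insert z)
  have hm : 0 < min r₁ ρ := lt_min hr₁ hρ
  set r := min r₁ ρ / 2 with hrdef
  have hr : 0 < r := half_pos hm
  have hrr₁ : r ≤ r₁ := (half_lt_self hm).le.trans (min_le_left _ _)
  obtain ⟨ε₁, hε₁, h1⟩ := hB r ⟨hr, (half_lt_self hm).trans_le (min_le_right _ _)⟩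
  have := hfin.to_subtype
  choose ε₂ hε₂ h2 using fun p : ↥(edgeSupp V D \ {z}) =>
    exists_edgeSupp_truncation_near K hD.2.1 hf hM p.2.1 hr
  obtain ⟨ε₃, hε₃, h3⟩ := exists_pos_le_of_finite ε₂ hε₂
  have hm' : 0 < min ε₁ (min ε₃ η) := lt_min hε₁ (lt_min hε₃ hη)
  obtain ⟨ε, hε0, hε⟩ : ∃ ε > 0, ε < min ε₁ (min ε₃ η) := ⟨_, half_pos hm', half_lt_self hm'⟩
  rw [lt_min_iff, lt_min_iff] at hε
  obtain ⟨B, hBn, hBs⟩ := h1 ε ⟨hε0, hε.1⟩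
  have hmem := LinSys.add_ordAt K hD (hf.max_const (M - ε))
    (add_ordAt_max_const_nonneg K hD.2.1 hf hfD _)
  have hdist : linDist D (fun x => D x + ordAt (fun y => max (f y) (M - ε)) x) < η :=
    ((linDist_le (hf.max_const _) fun x => rfl).trans (osc_max_const_le hε0.le hM)).trans_lt
      hε.2.2
  refine le_trans ?_ (hloc _ hmem hdist)
  rw [← hBn]
  refine ncard_add_le_of_near (z := z) (r := r) (fun h => h.2 rfl)
    (hmem.1.subset fun x hx => hx.2) hfin
    (fun x hx y hy hxy => by linarith [hsep x hx y hy hxy]) (fun p hp => ?_) hBs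
  exact h2 ⟨p, hp⟩ ε ⟨hε0, hε.2.1.trans_le (h3 _)⟩

theorem IsLocalMaxChips.tangentSlope_vertex (K : EdgeAtlas V) (hloc : IsLocalMaxChips V D₀ D)
    (hD : D ∈ LinSys D₀) (hf : IsRational f) (hfD : ∀ x, 0 ≤ D x + ordAt f x) {z : G}
    (hz : ∀ x, f x ≤ f z) (hzV : z ∈ V) (ζ : TangentDir z) : tangentSlope f ζ = 0 := by
  by_contra hne
  have hneg := lt_of_le_of_ne (tangentSlope_nonpos_of_isMax hf hz ζ) hne
  have hle := hloc.ncard_le K hD hf hfD hz (z := z) (n := 1) ⟨1, one_pos, fun r hr => by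
    obtain ⟨ε₀, hε₀, h⟩ := exists_ordAt_max_const_pos K hf ζ hneg hr.1
    refine ⟨ε₀, hε₀, fun ε hε => ?_⟩
    obtain ⟨t, -, hV, hd, hpos⟩ := h ε hε
    refine ⟨{dirPath ζ t}, ncard_singleton _, ?_⟩
    rintro _ rfl
    refine ⟨⟨hV, ?_⟩, hd⟩
    have := hD.2.1 (dirPath ζ t)
    simp only
    omega⟩
  rw [sdiff_singleton_eq_self fun h => h.1 hzV] at hle
  omega

theorem IsLocalMaxChips.exists_tangentSlope_edge (K : EdgeAtlas V)
    (hloc : IsLocalMaxChips V D₀ D)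
    (hD : D ∈ LinSys D₀) (hf : IsRational f) (hfD : ∀ x, 0 ≤ D x + ordAt f x) {z : G}
    (hz : ∀ x, f x ≤ f z) (hzV : z ∉ V) : ∃ ζ : TangentDir z, tangentSlope f ζ = 0 := by
  by_contra! hne
  have hneg : ∀ ζ : TangentDir z, tangentSlope f ζ < 0 := fun ζ =>
    lt_of_le_of_ne (tangentSlope_nonpos_of_isMax hf hz ζ) (hne ζ)
  obtain ⟨ζ, η, hζη, -⟩ := K.exists_two_dirs_of_notMem hzV
  obtain ⟨ρ, hρ⟩ := exists_starRadius K z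
  have hle := hloc.ncard_le K hD hf hfD hz (z := z) (n := 2) ⟨ρ, hρ.pos, fun r hr => by
    obtain ⟨ε₁, hε₁, h1⟩ := exists_ordAt_max_const_pos K hf ζ (hneg ζ) hr.1
    obtain ⟨ε₂, hε₂, h2⟩ := exists_ordAt_max_const_pos K hf η (hneg η) hr.1
    refine ⟨min ε₁ ε₂, lt_min hε₁ hε₂, fun ε hε => ?_⟩
    obtain ⟨t, ht, hV, hd, hpos⟩ := h1 ε ⟨hε.1, hε.2.trans_le (min_le_left _ _)⟩
    obtain ⟨t', ht', hV', hd', hpos'⟩ := h2 ε ⟨hε.1, hε.2.trans_le (min_le_right _ _)⟩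
    refine ⟨{dirPath ζ t, dirPath η t'}, ncard_pair fun heq => ?_, ?_⟩
    · have h3 := hρ.dist_dirPath ζ ⟨ht.1.le, ht.2.trans hr.2⟩
      have h4 := hρ.dist_dirPath η ⟨ht'.1.le, ht'.2.trans hr.2⟩
      have h5 : t = t' := by rw [← h3, ← h4, heq]
      subst h5
      exact hζη (hρ.inj ζ η t ⟨ht.1, ht.2.trans hr.2⟩ heq)
    · rintro _ (rfl | rfl)
      · refine ⟨⟨hV, ?_⟩, hd⟩
        have := hD.2.1 (dirPath ζ t)
        simp only
        omega
      · refine ⟨⟨hV', ?_⟩, hd'⟩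
        have := hD.2.1 (dirPath η t')
        simp only
        omega⟩
  have := Set.pred_ncard_le_ncard_sdiff_singleton (edgeSupp V D) z
  omega

/-- The cell dimension at a divisor with locally maximal number of edge chips bounds the rank. -/
theorem IsLocalMaxChips.le_cellDim [∀ x : G, Nonempty (TangentDir x)] (K : EdgeAtlas V)
    (hloc : IsLocalMaxChips V D₀ D) (hD : D ∈ LinSys D₀) {d : ℕ} (hd : rankGe D d) :
    (d : ℤ) ≤ cellDim V D := by
  have hS : (edgeSupp V D).Finite := hD.1.subset fun x hx => hx.2
  have hcomps := finite_compsOf_compl K hS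
  by_contra! hlt
  rw [cellDim] at hlt
  choose! p hpC hpD using fun C (hC : C ∈ compsOf (edgeSupp V D)ᶜ) =>
    exists_mem_comp_notMem K hS hD.1 hC
  have hcard : (p '' compsOf (edgeSupp V D)ᶜ).ncard ≤ d := by
    have := ncard_image_le (f := p) hcomps
    omega
  obtain ⟨E, hEf, hEe, hEd, hEp⟩ := exists_effective_of_finite (hcomps.image p) hcard
  obtain ⟨D', -, hD'e, f, hf, hfD'⟩ := hd E hEf hEe hEd
  have hfE : ∀ x, E x ≤ D x + ordAt f x := fun x => by
    have h1 := hD'e x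
    have h2 := hfD' x
    simp only at h2
    omega
  have hfD : ∀ x, 0 ≤ D x + ordAt f x := fun x => (hEe x).trans (hfE x)
  obtain ⟨z, -, hz⟩ := isCompact_univ.exists_isMaxOn univ_nonempty hf.1.continuousOn
  replace hz : ∀ x, f x ≤ f z := fun x => hz (mem_univ x)
  have hslope : ∀ x, f x = f z → x ∉ edgeSupp V D → ∀ ζ : TangentDir x, tangentSlope f ζ = 0 := by
    intro x hx hxS ζ
    have hmax : ∀ y, f y ≤ f x := fun y => (hz y).trans hx.ge
    by_cases hxV : x ∈ V
    · exact hloc.tangentSlope_vertex K hD hf hfD hmax hxV ζ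
    · have h0 : D x = 0 := by
        by_contra h0
        exact hxS ⟨hxV, h0⟩
      have := hfD x
      exact tangentSlope_eq_zero_of_isMax K hf hmax (by omega) ζ
  obtain ⟨q, hq, hqS⟩ : ∃ q, f q = f z ∧ q ∉ edgeSupp V D := by
    by_cases hzV : z ∈ V
    · exact ⟨z, rfl, fun h => h.1 hzV⟩
    · obtain ⟨ζ, hζ⟩ := hloc.exists_tangentSlope_edge K hD hf hfD hz hzV
      obtain ⟨r, hr, hlin⟩ := exists_starRadius_linear K hf z
      obtain ⟨t, ht, htS⟩ := hr.exists_notMem_finite ζ hS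
      exact ⟨_, by rw [hlin ζ t (Ioo_subset_Ico_self ht), hζ]; simp, htS⟩
  have hC := connectedComponentIn_mem_compsOf (S := (edgeSupp V D)ᶜ) hqS
  set C := connectedComponentIn (edgeSupp V D)ᶜ q
  have hlocal : ∀ x, f x = f z → x ∉ edgeSupp V D → x ∈ interior {y | f y = f z} := by
    intro x hx hxS
    obtain ⟨r, hr, h⟩ := eq_on_ball_of_tangentSlope_eq_zero K hf (hslope x hx hxS)
    rw [mem_interior_iff_mem_nhds, Metric.mem_nhds_iff]
    refine ⟨r, hr, fun y hy => ?_⟩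
    rw [Metric.mem_ball, dist_comm] at hy
    exact (h y hy).trans hx
  have hsub : C ⊆ interior {y | f y = f z} := by
    refine IsPreconnected.subset_left_of_subset_union isOpen_interior
      (isClosed_eq hf.1 (continuous_const (y := f z))).isOpen_compl ?_ ?_ ?_
      isPreconnected_connectedComponentIn
    · exact Set.disjoint_left.2 fun y hy hy' => hy' (interior_subset hy)
    · intro y hy
      by_cases hyz : f y = f z
      · exact Or.inl (hlocal y hyz (subset_of_mem_compsOf hC hy))
      · exact Or.inr hyz
    · exact ⟨q, mem_connectedComponentIn hqS, hlocal q hq hqS⟩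
  have hpz : f (p C) = f z := interior_subset (s := {y | f y = f z}) (hsub (hpC C hC))
  have h1 := ordAt_eq_zero_of_tangentSlope (hslope _ hpz (subset_of_mem_compsOf hC (hpC C hC)))
  have h2 := hfE (p C)
  have h3 := hEp (p C) ⟨C, hC, rfl⟩
  have h4 : D (p C) = 0 := by simpa using hpD C hC
  omega

end LocalMax

/-! ### Rearranging points of an interval -/

theorem exists_orderIso_apply_eq {a b x y : ℝ} (hx : x ∈ Ioo a b) (hy : y ∈ Ioo a b) :
    ∃ φ : ℝ ≃o ℝ, (∀ t ∉ Ioo a b, φ t = t) ∧ φ x = y := by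
  have hxa : 0 < x - a := sub_pos.2 hx.1
  have hxb : 0 < b - x := sub_pos.2 hx.2
  set τ : ℝ → ℝ := fun t => max 0 (min ((t - a) / (x - a)) ((b - t) / (b - x))) with hτ
  have hfix : ∀ t ∉ Ioo a b, τ t = 0 := by
    intro t ht
    rw [hτ]
    refine max_eq_left ?_
    by_cases hta : t ≤ a
    · exact (min_le_left _ _).trans (div_nonpos_of_nonpos_of_nonneg (by linarith) hxa.le)
    · have : b ≤ t := by
        by_contra! h
        exact ht ⟨not_le.1 hta, h⟩
      exact (min_le_right _ _).trans (div_nonpos_of_nonpos_of_nonneg (by linarith) hxb.le)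
  have hup : ∀ s t, s < t → τ t ≤ τ s + (t - s) / (x - a) := by
    intro s t hst
    have h0 : 0 ≤ (t - s) / (x - a) := div_nonneg (by linarith) hxa.le
    refine max_le ?_ ?_
    · have := le_max_left 0 (min ((s - a) / (x - a)) ((b - s) / (b - x)))
      linarith
    · refine le_trans ?_ (add_le_add_left (le_max_right _ _) _)
      rw [← min_add_add_right]
      refine le_min ((min_le_left _ _).trans (le_of_eq ?_)) ((min_le_right _ _).trans ?_)
      · rw [← add_div]; ring_nf
      · have : (b - t) / (b - x) ≤ (b - s) / (b - x) :=
          div_le_div_of_nonneg_right (by linarith) hxb.le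
        linarith
  have hdown : ∀ s t, s < t → τ s ≤ τ t + (t - s) / (b - x) := by
    intro s t hst
    have h0 : 0 ≤ (t - s) / (b - x) := div_nonneg (by linarith) hxb.le
    refine max_le ?_ ?_
    · have := le_max_left 0 (min ((t - a) / (x - a)) ((b - t) / (b - x)))
      linarith
    · refine le_trans ?_ (add_le_add_left (le_max_right _ _) _)
      rw [← min_add_add_right]
      refine le_min ((min_le_left _ _).trans ?_) ((min_le_right _ _).trans (le_of_eq ?_))
      · have : (s - a) / (x - a) ≤ (t - a) / (x - a) :=
          div_le_div_of_nonneg_right (by linarith) hxa.le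
        linarith
      · rw [← add_div]; ring_nf
  have hcont : Continuous fun t => t + (y - x) * τ t := by
    simp only [hτ]
    fun_prop
  have hmono : StrictMono fun t => t + (y - x) * τ t := by
    intro s t hst
    have h1 := hup s t hst
    have h2 := hdown s t hst
    have h3 : (t - s) / (x - a) * (x - a) = t - s := div_mul_cancel₀ _ hxa.ne'
    have h4 : (t - s) / (b - x) * (b - x) = t - s := div_mul_cancel₀ _ hxb.ne'
    have h5 : 0 < (t - s) / (x - a) := div_pos (by linarith) hxa
    have h6 : 0 < (t - s) / (b - x) := div_pos (by linarith) hxb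
    have hya := hy.1
    have hyb := hy.2
    simp only
    rcases le_total x y with hxy | hxy
    · have := mul_le_mul_of_nonneg_left h2 (sub_nonneg.2 hxy)
      nlinarith [mul_pos h6 (sub_pos.2 hyb)]
    · have := mul_le_mul_of_nonneg_left h1 (sub_nonneg.2 hxy)
      nlinarith [mul_pos h5 (sub_pos.2 hya)]
  have hsurj : Surjective fun t => t + (y - x) * τ t := by
    refine hcont.surjective (Filter.tendsto_id.congr' ?_) (Filter.tendsto_id.congr' ?_)
    · filter_upwards [Filter.eventually_ge_atTop b] with t ht
      rw [hfix t fun h => ht.not_gt h.2, mul_zero, add_zero, id]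
    · filter_upwards [Filter.eventually_le_atBot a] with t ht
      rw [hfix t fun h => ht.not_gt h.1, mul_zero, add_zero, id]
  refine ⟨hmono.orderIsoOfSurjective _ hsurj, fun t ht => ?_, ?_⟩
  · simp [hfix t ht]
  · simp [hτ, div_self hxa.ne', div_self hxb.ne']

theorem exists_orderIso_map_eq {b : ℝ} : ∀ (l l' : List ℝ) (a : ℝ), l.length = l'.length →
    l.Pairwise (· < ·) → l'.Pairwise (· < ·) → (∀ x ∈ l, x ∈ Ioo a b) → (∀ x ∈ l', x ∈ Ioo a b) →
    ∃ φ : ℝ ≃o ℝ, (∀ t ∉ Ioo a b, φ t = t) ∧ l.map φ = l'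
  | [], [], _, _, _, _, _, _ => ⟨OrderIso.refl ℝ, fun _ _ => rfl, rfl⟩
  | x :: l, y :: l', a, hlen, hl, hl', hm, hm' => by
    rw [List.pairwise_cons] at hl hl'
    have hx := hm x List.mem_cons_self
    have hy := hm' y List.mem_cons_self
    obtain ⟨φ, hφ, hφx⟩ := exists_orderIso_apply_eq hx hy
    obtain ⟨ψ, hψ, hψl⟩ := exists_orderIso_map_eq (b := b) (l.map φ) l' y (by simpa using hlen)
      (hl.2.map φ fun _ _ h => φ.strictMono h) hl'.2
      (fun z hz => by
        obtain ⟨w, hw, rfl⟩ := List.mem_map.1 hz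
        refine ⟨hφx ▸ φ.strictMono (hl.1 w hw), ?_⟩
        have h1 := φ.strictMono (hm w (List.mem_cons_of_mem _ hw)).2
        rwa [hφ b fun h => h.2.false] at h1)
      fun z hz => ⟨hl'.1 z hz, (hm' z (List.mem_cons_of_mem _ hz)).2⟩
    refine ⟨φ.trans ψ, fun t ht => ?_, ?_⟩
    · rw [OrderIso.trans_apply, hφ t ht, hψ t fun h => ht ⟨hy.1.trans h.1, h.2⟩]
    · rw [List.map_cons, OrderIso.trans_apply, hφx, hψ y fun h => h.1.false, ← hψl, List.map_map]
      rfl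

/-- The values of `u` along its support in `(0, b)`, in increasing order of position. -/
noncomputable def profile (b : ℝ) (u : ℝ → ℤ) : List ℤ :=
  open scoped Classical in
  if h : (Ioo 0 b ∩ Function.support u).Finite then (h.toFinset.sort (· ≤ ·)).map u else []

theorem profile_eq {b : ℝ} {u : ℝ → ℤ} (h : (Ioo 0 b ∩ Function.support u).Finite) :
    profile b u = (h.toFinset.sort (· ≤ ·)).map u := dif_pos h

theorem exists_orderIso_of_profile_eq {b : ℝ} {u w : ℝ → ℤ}
    (hu : (Ioo 0 b ∩ Function.support u).Finite) (hw : (Ioo 0 b ∩ Function.support w).Finite)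
    (h : profile b u = profile b w) :
    ∃ φ : ℝ ≃o ℝ, (∀ t ∉ Ioo 0 b, φ t = t) ∧ ∀ t ∈ Ioo 0 b, w (φ t) = u t := by
  rw [profile_eq hu, profile_eq hw] at h
  obtain ⟨φ, hφ, hl⟩ := exists_orderIso_map_eq (b := b) (hu.toFinset.sort (· ≤ ·))
    (hw.toFinset.sort (· ≤ ·)) 0 (by simpa using congrArg List.length h)
    (Finset.sortedLT_sort _).pairwise (Finset.sortedLT_sort _).pairwise
    (fun x hx => by simp only [Finset.mem_sort, Finite.mem_toFinset] at hx; exact hx.1)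
    (fun x hx => by simp only [Finset.mem_sort, Finite.mem_toFinset] at hx; exact hx.1)
  have hmem : ∀ t ∈ Ioo 0 b, φ t ∈ Ioo 0 b := fun t ht => by
    have h0 := φ.strictMono ht.1
    have h1 := φ.strictMono ht.2
    rw [hφ 0 fun h => h.1.false] at h0
    rw [hφ b fun h => h.2.false] at h1
    exact ⟨h0, h1⟩
  refine ⟨φ, hφ, fun t ht => ?_⟩
  rw [← hl, List.map_map] at h
  by_cases htu : t ∈ hu.toFinset
  · exact (List.map_inj_left.1 h t ((Finset.mem_sort _).2 htu)).symm
  · have hut : u t = 0 := by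
      by_contra hne
      exact htu (hu.mem_toFinset.2 ⟨ht, hne⟩)
    rw [hut]
    by_contra hne
    have h1 : φ t ∈ hw.toFinset.sort (· ≤ ·) :=
      (Finset.mem_sort _).2 (hw.mem_toFinset.2 ⟨hmem t ht, hne⟩)
    rw [← hl] at h1
    obtain ⟨s, hs, hst⟩ := List.mem_map.1 h1
    exact htu (φ.injective hst ▸ (Finset.mem_sort _).1 hs)

theorem length_le_sum_of_pos : ∀ l : List ℤ, (∀ x ∈ l, 1 ≤ x) → (l.length : ℤ) ≤ l.sum
  | [], _ => by simp
  | x :: l, h => by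
    have h1 := h x List.mem_cons_self
    have h2 := length_le_sum_of_pos l fun y hy => h y (List.mem_cons_of_mem _ hy)
    simp only [List.length_cons, List.sum_cons]
    push_cast
    linarith

theorem finite_setOf_list_sum_le (N : ℤ) :
    {l : List ℤ | (∀ x ∈ l, 1 ≤ x) ∧ l.sum ≤ N}.Finite := by
  have h1 : {l : List (Icc 1 N) | l.length ≤ N.toNat}.Finite := List.finite_length_le _ _
  refine (h1.image (List.map Subtype.val)).subset ?_
  rintro l ⟨hl, hN⟩
  have hle : ∀ x ∈ l, x ≤ N := fun x hx =>
    (List.single_le_sum (fun y hy => by linarith [hl y hy]) x hx).trans hN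
  refine ⟨l.attach.map fun x => ⟨x.1, hl _ x.2, hle _ x.2⟩, ?_, ?_⟩
  · have := length_le_sum_of_pos l hl
    simp only [mem_ofPred_eq, List.length_map, List.length_attach]
    omega
  · rw [List.map_map]
    exact List.attach_map_subtype_val l

theorem profile_mem {b : ℝ} {u : ℝ → ℤ} (h : (Ioo 0 b ∩ Function.support u).Finite)
    (h0 : ∀ t, 0 ≤ u t) {x : ℤ} (hx : x ∈ profile b u) : 1 ≤ x := by
  rw [profile_eq h] at hx
  obtain ⟨t, ht, rfl⟩ := List.mem_map.1 hx
  rw [Finset.mem_sort, Finite.mem_toFinset] at ht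
  have := h0 t
  have := ht.2
  rw [Function.mem_support] at this
  omega

theorem sum_profile {b : ℝ} {u : ℝ → ℤ} (h : (Ioo 0 b ∩ Function.support u).Finite) :
    (profile b u).sum = ∑ t ∈ h.toFinset, u t := by
  rw [profile_eq h, ← List.sum_toFinset u (Finset.sort_nodup _ _), Finset.sort_toFinset]

/-! ### Homeomorphisms of the graph from homeomorphisms of its edges -/

namespace EdgeAtlas

variable {V : Set G} (K : EdgeAtlas V)

open scoped Classical in
/-- The self-map of the graph fixing `V` and acting as `φ e` in the coordinate of each edge. -/
noncomputable def edgeMap (φ : compsOf Vᶜ → ℝ ≃o ℝ) (x : G) : G :=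
  if h : x ∈ V then x else
    K.map (K.exists_map_eq h).choose (φ (K.exists_map_eq h).choose
      (K.exists_map_eq h).choose_spec.choose)

theorem edgeMap_of_mem (φ : compsOf Vᶜ → ℝ ≃o ℝ) {x : G} (h : x ∈ V) : K.edgeMap φ x = x :=
  dif_pos h

theorem edgeMap_map {φ : compsOf Vᶜ → ℝ ≃o ℝ} (hφ : ∀ e, ∀ t ∉ Ioo 0 (K.len e), φ e t = t)
    {e : compsOf Vᶜ} {t : ℝ} (ht : t ∈ Icc 0 (K.len e)) :
    K.edgeMap φ (K.map e t) = K.map e (φ e t) := by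
  by_cases hti : t ∈ Ioo 0 (K.len e)
  · have h := K.map_notMem hti
    rw [edgeMap, dif_neg h]
    have hs := (K.exists_map_eq h).choose_spec.choose_spec
    obtain ⟨h1, h2⟩ := K.map_eq_map hti (Ioo_subset_Icc_self hs.1) hs.2.symm
    rw [← h2, ← h1]
  · rw [hφ e t hti]
    refine K.edgeMap_of_mem φ ?_
    rcases eq_endpoints_or_mem_Ioo_of_mem_Icc ht with rfl | rfl | h
    · exact K.left e
    · exact K.right e
    · exact absurd h hti

theorem mem_Icc_of_fix {φ : ℝ ≃o ℝ} {b : ℝ} (hφ : ∀ t ∉ Ioo 0 b, φ t = t) {t : ℝ}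
    (ht : t ∈ Icc 0 b) : φ t ∈ Icc 0 b := by
  have h0 := φ.monotone ht.1
  have h1 := φ.monotone ht.2
  rw [hφ 0 fun h => h.1.false] at h0
  rw [hφ b fun h => h.2.false] at h1
  exact ⟨h0, h1⟩

theorem continuous_edgeMap {φ : compsOf Vᶜ → ℝ ≃o ℝ}
    (hφ : ∀ e, ∀ t ∉ Ioo 0 (K.len e), φ e t = t) : Continuous (K.edgeMap φ) := by
  have := K.finE
  let s : Option (compsOf Vᶜ) → Set G := fun o =>
    o.elim V fun e => K.map e '' Icc 0 (K.len e)
  refine (locallyFinite_of_finite s).continuous (eq_univ_of_forall fun x => ?_) ?_ ?_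
  · by_cases hx : x ∈ V
    · exact mem_iUnion.2 ⟨none, hx⟩
    · obtain ⟨e, t, ht, rfl⟩ := K.exists_map_eq hx
      exact mem_iUnion.2 ⟨some e, t, Ioo_subset_Icc_self ht, rfl⟩
  · rintro (_ | e)
    · exact K.finV.isClosed
    · exact K.isClosed_image e
  · rintro (_ | e)
    · exact continuousOn_id.congr fun x hx => K.edgeMap_of_mem φ hx
    · have hd : ∀ t ∈ Icc 0 (K.len e), dist (K.map e 0) (K.map e t) = t := fun t ht => by
        rw [K.isom e 0 ⟨le_rfl, (K.len_pos e).le⟩ t ht, zero_sub, abs_neg, abs_of_nonneg ht.1]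
      have hc : ContinuousOn (fun x => K.map e (φ e (dist (K.map e 0) x)))
          (K.map e '' Icc 0 (K.len e)) := by
        refine (K.continuousOn_map e).comp
          ((φ e).continuous.comp (continuous_const.dist continuous_id)).continuousOn ?_
        rintro _ ⟨t, ht, rfl⟩
        change φ e (dist (K.map e 0) (K.map e t)) ∈ _
        rw [hd t ht]
        exact mem_Icc_of_fix (hφ e) ht
      refine hc.congr ?_
      rintro _ ⟨t, ht, rfl⟩
      simp only
      rw [hd t ht, K.edgeMap_map hφ ht]

theorem edgeMap_symm_edgeMap {φ : compsOf Vᶜ → ℝ ≃o ℝ}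
    (hφ : ∀ e, ∀ t ∉ Ioo 0 (K.len e), φ e t = t) (hψ : ∀ e, ∀ t ∉ Ioo 0 (K.len e),
      (φ e).symm t = t) (x : G) :
    K.edgeMap (fun e => (φ e).symm) (K.edgeMap φ x) = x := by
  by_cases hx : x ∈ V
  · rw [K.edgeMap_of_mem φ hx, K.edgeMap_of_mem _ hx]
  · obtain ⟨e, t, ht, rfl⟩ := K.exists_map_eq hx
    rw [K.edgeMap_map hφ (Ioo_subset_Icc_self ht),
      K.edgeMap_map hψ (mem_Icc_of_fix (hφ e) (Ioo_subset_Icc_self ht)),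
      OrderIso.symm_apply_apply]

/-- Order automorphisms of the edges glue to a homeomorphism of the graph. -/
theorem exists_homeomorph {φ : compsOf Vᶜ → ℝ ≃o ℝ}
    (hφ : ∀ e, ∀ t ∉ Ioo 0 (K.len e), φ e t = t) :
    ∃ h : G ≃ₜ G, (∀ v ∈ V, h v = v) ∧
      ∀ e, ∀ t ∈ Ioo 0 (K.len e), h (K.map e t) = K.map e (φ e t) := by
  have hψ : ∀ e, ∀ t ∉ Ioo 0 (K.len e), (φ e).symm t = t := fun e t ht => by
    rw [OrderIso.symm_apply_eq, hφ e t ht]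
  refine ⟨⟨⟨K.edgeMap φ, K.edgeMap fun e => (φ e).symm, K.edgeMap_symm_edgeMap hφ hψ,
    K.edgeMap_symm_edgeMap hψ hφ⟩, K.continuous_edgeMap hφ, K.continuous_edgeMap hψ⟩,
    fun v hv => K.edgeMap_of_mem φ hv, fun e t ht => K.edgeMap_map hφ (Ioo_subset_Icc_self ht)⟩

theorem finite_Ioo_inter_support {D : G → ℤ} (hD : FinSupp D) (e : compsOf Vᶜ) :
    (Ioo 0 (K.len e) ∩ Function.support fun t => D (K.map e t)).Finite := by
  refine Set.Finite.of_finite_image (f := K.map e) (hD.subset ?_) fun s hs t ht h =>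
    K.map_inj (Ioo_subset_Icc_self hs.1) (Ioo_subset_Icc_self ht.1) h
  rintro _ ⟨t, ht, rfl⟩
  exact ht.2

/-- Divisors with the same vertex values and the same chip sequences on every edge are related
by a homeomorphism preserving the model. -/
theorem exists_homeomorph_of_profile_eq {D₁ D₂ : G → ℤ} (h₁ : FinSupp D₁) (h₂ : FinSupp D₂)
    (hV : ∀ v ∈ V, D₁ v = D₂ v)
    (h : ∀ e, profile (K.len e) (fun t => D₁ (K.map e t)) =
      profile (K.len e) (fun t => D₂ (K.map e t))) :
    ∃ h : G ≃ₜ G, (∀ v ∈ V, h v = v) ∧ (∀ x ∉ V, h x ∈ connectedComponentIn Vᶜ x) ∧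
      ∀ x, D₂ (h x) = D₁ x := by
  choose φ hφ hφD using fun e => exists_orderIso_of_profile_eq
    (K.finite_Ioo_inter_support h₁ e) (K.finite_Ioo_inter_support h₂ e) (h e)
  obtain ⟨k, hkV, hk⟩ := K.exists_homeomorph hφ
  refine ⟨k, hkV, fun x hx => ?_, fun x => ?_⟩
  · obtain ⟨e, t, ht, rfl⟩ := K.exists_map_eq hx
    have h1 : connectedComponentIn Vᶜ (K.map e t) = e :=
      eq_of_mem_compsOf (connectedComponentIn_mem_compsOf hx) e.2 (mem_connectedComponentIn hx)
        (K.map_mem ht)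
    rw [h1, hk e t ht]
    refine K.map_mem ⟨?_, ?_⟩
    · have h0 := (φ e).strictMono ht.1
      rwa [hφ e 0 fun h => h.1.false] at h0
    · have h0 := (φ e).strictMono ht.2
      rwa [hφ e (K.len e) fun h => h.2.false] at h0
  · by_cases hx : x ∈ V
    · rw [hkV x hx, hV x hx]
    · obtain ⟨e, t, ht, rfl⟩ := K.exists_map_eq hx
      rw [hk e t ht]
      exact hφD e t ht

end EdgeAtlas

/-! ### Bounds on the combinatorial type of a nearby divisor -/

theorem eq_add_sum_of_slopes {b k : ℝ} (A : Finset ℝ) (m : ℝ → ℝ) {F : ℝ → ℝ}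
    (hF : ContinuousOn F (Ico 0 b)) (hA : ∀ a ∈ A, 0 < a)
    (hk : ∃ δ > 0, ∀ s ∈ Ico 0 δ, F s = F 0 + k * s)
    (h : ∀ t ∈ Ioo 0 b, ∃ L R : ℝ, L + R = (if t ∈ A then m t else 0) ∧ ∃ δ > 0, ∀ s ∈ Ico 0 δ,
      F (t + s) = F t + R * s ∧ F (t - s) = F t + L * s) {t : ℝ} (ht : t ∈ Ico 0 b) :
    F t = F 0 + k * t + ∑ a ∈ A, m a * max (t - a) 0 := by
  classical
  induction A using Finset.induction_on generalizing F with
  | empty =>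
    simp only [Finset.notMem_empty, if_false, Finset.sum_empty, add_zero] at h ⊢
    refine le_antisymm ?_ (le_of_slopes_add_nonneg hF hk (fun s hs => ?_) ht)
    · have := le_of_slopes_add_nonneg (F := fun s => -F s) (k := -k) hF.neg ?_ ?_ ht
      · linarith
      · obtain ⟨δ, hδ, h'⟩ := hk
        exact ⟨δ, hδ, fun s hs => by rw [h' s hs]; ring⟩
      · intro s hs
        obtain ⟨L, R, hLR, δ, hδ, h'⟩ := h s hs
        exact ⟨-L, -R, by linarith, δ, hδ, fun u hu => by
          rw [(h' u hu).1, (h' u hu).2]; constructor <;> ring⟩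
    · obtain ⟨L, R, hLR, h'⟩ := h s hs
      exact ⟨L, R, hLR.ge, h'⟩
  | insert a A ha ih =>
    have ha0 := hA a (Finset.mem_insert_self _ _)
    have := ih (F := fun t => F t - m a * max (t - a) 0) (hF.sub (by fun_prop))
      (fun c hc => hA c (Finset.mem_insert_of_mem hc)) ?_ ?_
    · simp only [zero_sub] at this
      rw [max_eq_right (by linarith : -a ≤ 0)] at this
      rw [Finset.sum_insert ha]
      linarith
    · obtain ⟨δ, hδ, h'⟩ := hk
      refine ⟨min δ a, lt_min hδ ha0, fun s hs => ?_⟩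
      rw [h' s ⟨hs.1, hs.2.trans_le (min_le_left _ _)⟩,
        max_eq_right (by linarith [hs.2.trans_le (min_le_right δ a)]), max_eq_right (by linarith)]
      ring
    · intro t ht
      obtain ⟨L, R, hLR, δ, hδ, h'⟩ := h t ht
      simp only [Finset.mem_insert] at hLR
      rcases lt_trichotomy t a with hta | rfl | hta
      · refine ⟨L, R, by rw [hLR]; simp [hta.ne], min δ (a - t), lt_min hδ (by linarith),
          fun s hs => ?_⟩
        have hs' := hs.2.trans_le (min_le_right δ (a - t))
        obtain ⟨h1, h2⟩ := h' s ⟨hs.1, hs.2.trans_le (min_le_left _ _)⟩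
        have := hs.1
        rw [h1, h2, max_eq_right (by linarith), max_eq_right (by linarith),
          max_eq_right (by linarith)]
        constructor <;> ring
      · refine ⟨L, R - m t, by rw [if_pos (Or.inl rfl)] at hLR; rw [if_neg ha]; linarith, δ, hδ,
          fun s hs => ?_⟩
        obtain ⟨h1, h2⟩ := h' s hs
        have := hs.1
        rw [h1, h2, max_eq_left (by linarith), max_eq_right (by linarith),
          max_eq_right (by linarith)]
        constructor <;> ring
      · refine ⟨L + m a, R - m a, by rw [add_add_sub_cancel, hLR]; simp [hta.ne'], min δ (t - a),
          lt_min hδ (by linarith), fun s hs => ?_⟩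
        have hs' := hs.2.trans_le (min_le_right δ (t - a))
        obtain ⟨h1, h2⟩ := h' s ⟨hs.1, hs.2.trans_le (min_le_left _ _)⟩
        have := hs.1
        rw [h1, h2, max_eq_left (by linarith), max_eq_left (by linarith),
          max_eq_left (by linarith)]
        constructor <;> ring

theorem EdgeAtlas.sum_ordAt_eq {V : Set G} (K : EdgeAtlas V) {f : G → ℝ} (hf : IsRational f)
    (e : compsOf Vᶜ) {k₀ k₁ : ℤ}
    (h₀ : ∃ δ > 0, ∀ s ∈ Ico 0 δ, f (K.map e s) = f (K.map e 0) + k₀ * s)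
    (h₁ : ∃ δ > 0, ∀ s ∈ Ico 0 δ, f (K.map e (K.len e - s)) = f (K.map e (K.len e)) + k₁ * s)
    {A : Finset ℝ} (hA : ∀ a ∈ A, a ∈ Ioo 0 (K.len e))
    (hA' : ∀ t ∈ Ioo 0 (K.len e), ordAt f (K.map e t) ≠ 0 → t ∈ A) :
    ∑ a ∈ A, ordAt f (K.map e a) = -k₀ - k₁ := by
  have hb := K.len_pos e
  have key : ∀ t ∈ Ico 0 (K.len e), f (K.map e t) = f (K.map e 0) + k₀ * t +
      ∑ a ∈ A, (ordAt f (K.map e a) : ℝ) * max (t - a) 0 := fun t ht => by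
    refine eq_add_sum_of_slopes (F := fun t => f (K.map e t)) A
      (fun a => (ordAt f (K.map e a) : ℝ))
      (hf.1.comp_continuousOn ((K.continuousOn_map e).mono Ico_subset_Icc_self))
      (fun a ha => (hA a ha).1) h₀ (fun s hs => ?_) ht
    obtain ⟨L, R, hLR, h⟩ := K.exists_slopes hf hs
    refine ⟨L, R, ?_, h⟩
    split_ifs with hsA
    · rw [hLR]; push_cast; rfl
    · have : ordAt f (K.map e s) = 0 := by
        by_contra hne
        exact hsA (hA' s hs hne)
      rw [hLR] at this
      exact_mod_cast this
  obtain ⟨δ, hδ, h₁⟩ := h₁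
  obtain ⟨u₁, hu₁, hu₁'⟩ := exists_pos_le_of_finite (fun a : A => K.len e - a)
    fun a => sub_pos.2 (hA a a.2).2
  obtain ⟨u, hu0, hu⟩ : ∃ u > 0, u < min u₁ (min δ (K.len e)) :=
    ⟨_, half_pos (lt_min hu₁ (lt_min hδ hb)), half_lt_self (lt_min hu₁ (lt_min hδ hb))⟩
  rw [lt_min_iff, lt_min_iff] at hu
  have hval : ∀ s ∈ Ioc 0 u, f (K.map e (K.len e)) + k₁ * s = f (K.map e 0) +
      k₀ * (K.len e - s) + ∑ a ∈ A, (ordAt f (K.map e a) : ℝ) * (K.len e - s - a) := by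
    intro s hs
    rw [← h₁ s ⟨hs.1.le, hs.2.trans_lt hu.2.1⟩, key _ ⟨by linarith [hs.2], by linarith [hs.1]⟩]
    congr 1
    refine Finset.sum_congr rfl fun a ha => ?_
    have := hu₁' ⟨a, ha⟩
    simp only at this
    rw [max_eq_left (by linarith [hs.2])]
  have e1 := hval u ⟨hu0, le_rfl⟩
  have e2 := hval (u / 2) ⟨by linarith, by linarith⟩
  have e3 : ∑ a ∈ A, (ordAt f (K.map e a) : ℝ) * (K.len e - u / 2 - a) -
      ∑ a ∈ A, (ordAt f (K.map e a) : ℝ) * (K.len e - u - a) =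
      (∑ a ∈ A, (ordAt f (K.map e a) : ℝ)) * (u / 2) := by
    rw [← Finset.sum_sub_distrib, Finset.sum_mul]
    refine Finset.sum_congr rfl fun a _ => ?_
    ring
  have e4 : ((∑ a ∈ A, (ordAt f (K.map e a) : ℝ)) + k₀ + k₁) * (u / 2) = 0 := by
    linear_combination e1 - e2 - e3
  have e5 := (mul_eq_zero.1 e4).resolve_right (half_pos hu0).ne'
  have e6 : (((∑ a ∈ A, ordAt f (K.map e a)) + k₀ + k₁ : ℤ) : ℝ) = 0 := by
    push_cast
    exact e5
  have e7 : (∑ a ∈ A, ordAt f (K.map e a)) + k₀ + k₁ = 0 := by exact_mod_cast e6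
  linarith

section Bounds

variable [CompactSpace G] [Nonempty G] {V : Set G} {D : G → ℤ}

theorem exists_tangentSlope_nonpos_near (K : EdgeAtlas V) (hD : FinSupp D) (x : G) :
    ∃ δ > 0, ∀ (g : G → ℝ) (D' : G → ℤ), IsRational g → Effective D' →
      (∀ y, D' y = D y + ordAt g y) → osc g < δ → ∀ ζ : TangentDir x, tangentSlope g ζ ≤ 0 := by
  obtain ⟨r₁, hr₁⟩ := exists_starRadius K x
  have hfin : (Function.support D \ {x}).Finite := Set.Finite.subset hD sdiff_subset
  obtain ⟨r₂, hr₂, h2⟩ := Metric.isOpen_iff.1 hfin.isClosed.isOpen_compl x fun h => h.2 rfl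
  have hr := hr₁.mono (lt_min hr₁.pos hr₂) (min_le_left _ _)
  have hrr : min r₁ r₂ ≤ r₂ := min_le_right _ _
  set r := min r₁ r₂
  refine ⟨r / 2, half_pos hr.pos, fun g D' hg hD' h hosc ζ => ?_⟩
  have hle := hr.le_of_ordAt_nonneg hg ζ (fun t ht => ?_) (t := r / 2)
    ⟨(half_pos hr.pos).le, half_lt_self hr.pos⟩
  · have h1 := sub_le_osc hg.1 (dirPath ζ (r / 2)) x
    have h3 : (tangentSlope g ζ : ℝ) * (r / 2) < 1 * (r / 2) := by linarith
    have h4 := lt_of_mul_lt_mul_right h3 (half_pos hr.pos).le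
    have h5 : tangentSlope g ζ < 1 := by exact_mod_cast h4
    omega
  · have hd := hr.dist_dirPath ζ (Ioo_subset_Ico_self ht)
    have hz : D (dirPath ζ t) = 0 := by
      by_contra hne
      refine h2 (?_ : dirPath ζ t ∈ Metric.ball x r₂) ⟨hne, fun heq => ?_⟩
      · rw [Metric.mem_ball, dist_comm, hd]
        exact ht.2.trans_le hrr
      · rw [mem_singleton_iff.1 heq, dist_self] at hd
        exact ht.1.ne hd
    have h6 := h (dirPath ζ t)
    have h7 := hD' (dirPath ζ t)
    omega

theorem neg_le_tangentSlope (K : EdgeAtlas V) {g : G → ℝ} {D' : G → ℤ} (hD' : Effective D')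
    {x : G} (h : D' x = D x + ordAt g x) (hle : ∀ ζ : TangentDir x, tangentSlope g ζ ≤ 0)
    (ζ : TangentDir x) : -D x ≤ tangentSlope g ζ := by
  have := K.finite_tangentDir x
  have := Fintype.ofFinite (TangentDir x)
  have h0 := hD' x
  rw [h, ordAt, finsum_eq_sum_of_fintype] at h0
  have : ∑ η : TangentDir x, tangentSlope g η ≤ tangentSlope g ζ := by
    classical
    rw [← Finset.add_sum_erase _ _ (Finset.mem_univ ζ)]
    linarith [Finset.sum_nonpos fun η (_ : η ∈ Finset.univ.erase ζ) => hle η]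
  linarith

theorem ordAt_nonpos (K : EdgeAtlas V) {g : G → ℝ} {x : G}
    (hle : ∀ ζ : TangentDir x, tangentSlope g ζ ≤ 0) : ordAt g x ≤ 0 := by
  have := K.finite_tangentDir x
  have := Fintype.ofFinite (TangentDir x)
  rw [ordAt, finsum_eq_sum_of_fintype]
  exact Finset.sum_nonpos fun η _ => hle η

theorem sum_le_sum_support {ι : Type*} (hD : FinSupp D) (hDe : Effective D) {A : Finset ι}
    {p : ι → G} (hp : InjOn p A) : ∑ a ∈ A, D (p a) ≤ ∑ x ∈ Set.Finite.toFinset hD, D x := by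
  classical
  rw [← Finset.sum_image hp, Finset.sum_subset
    (Finset.subset_union_right (s₁ := A.image p) (s₂ := Set.Finite.toFinset hD)) fun x _ hx => ?_]
  · exact Finset.sum_le_sum_of_subset_of_nonneg Finset.subset_union_left fun x _ _ => hDe x
  · by_contra hne
    exact hx ((Set.Finite.mem_toFinset hD).2 hne)

theorem exists_type_bounds (K : EdgeAtlas V) (hD : FinSupp D) (hDe : Effective D) :
    ∃ δ > 0, ∃ N : ℤ, ∀ (g : G → ℝ) (D' : G → ℤ), IsRational g → FinSupp D' → Effective D' →
      (∀ y, D' y = D y + ordAt g y) → osc g < δ →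
      (∀ v ∈ V, D' v ∈ Icc 0 N ∧ ∀ ζ : TangentDir v, tangentSlope g ζ ∈ Icc (-N) 0) ∧
      ∀ e, (profile (K.len e) fun t => D' (K.map e t)).sum ≤ 3 * N := by
  have := K.finV.to_subtype
  choose δ hδ h using fun v : V => exists_tangentSlope_nonpos_near K hD v
  obtain ⟨δ₀, hδ₀, hδ'⟩ := exists_pos_le_of_finite δ hδ
  set N : ℤ := ∑ x ∈ Set.Finite.toFinset hD, D x with hN
  have hDN : ∀ x, D x ≤ N := fun x => by
    simpa using sum_le_sum_support hD hDe (A := {x}) (p := id) (injOn_id _)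
  refine ⟨δ₀, hδ₀, N, fun g D' hg hf' he' hgD hosc => ?_⟩
  have hle : ∀ v ∈ V, ∀ ζ : TangentDir v, tangentSlope g ζ ≤ 0 := fun v hv =>
    h ⟨v, hv⟩ g D' hg he' hgD (hosc.trans_le (hδ' _))
  have hge : ∀ v ∈ V, ∀ ζ : TangentDir v, -N ≤ tangentSlope g ζ := fun v hv ζ => by
    have := neg_le_tangentSlope K he' (hgD v) (hle v hv) ζ
    have := hDN v
    omega
  refine ⟨fun v hv => ⟨⟨he' v, ?_⟩, fun ζ => ⟨hge v hv ζ, hle v hv ζ⟩⟩, fun e => ?_⟩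
  · have h1 := hgD v
    have h2 := ordAt_nonpos K (hle v hv)
    have h3 := hDN v
    omega
  · classical
    have hb := K.len_pos e
    have hT' := K.finite_Ioo_inter_support hf' e
    have hT := K.finite_Ioo_inter_support hD e
    rw [sum_profile hT']
    set A := hT'.toFinset ∪ hT.toFinset with hA
    have hAI : ∀ a ∈ A, a ∈ Ioo 0 (K.len e) := by
      intro a ha
      rcases Finset.mem_union.1 ha with ha | ha
      · exact (hT'.mem_toFinset.1 ha).1
      · exact (hT.mem_toFinset.1 ha).1
    have hs₀ : ∀ s ∈ Ico 0 (K.len e), 0 + 1 * s ∈ Icc 0 (K.len e) := fun s hs =>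
      ⟨by linarith [hs.1], by linarith [hs.2]⟩
    have hs₁ : ∀ s ∈ Ico 0 (K.len e), K.len e + -1 * s ∈ Icc 0 (K.len e) := fun s hs =>
      ⟨by linarith [hs.2], by linarith [hs.1]⟩
    obtain ⟨k₀, b₀, δ₁, hδ₁, h₁⟩ : ∃ k ≥ -N, HasSlopeAlong g _ k :=
      ⟨_, hge _ (K.left e) _, K.hasSlopeAlong_map hg (Or.inl rfl) hb hs₀⟩
    obtain ⟨k₁, b₁, δ₂, hδ₂, h₂⟩ : ∃ k ≥ -N, HasSlopeAlong g _ k :=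
      ⟨_, hge _ (K.right e) _, K.hasSlopeAlong_map hg (Or.inr rfl) hb hs₁⟩
    have hsum := K.sum_ordAt_eq hg e
      ⟨δ₁, hδ₁, fun s hs => by have := h₁ s hs; simpa using this⟩
      ⟨δ₂, hδ₂, fun s hs => by have := h₂ s hs; simpa [← sub_eq_add_neg] using this⟩
      hAI fun t ht hne => by
        have h1 := hgD (K.map e t)
        by_cases hDt : D (K.map e t) = 0
        · exact Finset.mem_union_left _ (hT'.mem_toFinset.2 ⟨ht, fun h0 => hne (by
            have h2 : D' (K.map e t) = 0 := h0
            omega)⟩)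
        · exact Finset.mem_union_right _ (hT.mem_toFinset.2 ⟨ht, hDt⟩)
    have h3 : ∑ a ∈ A, D (K.map e a) ≤ N := sum_le_sum_support hD hDe fun s hs t ht hst =>
      K.map_inj (Ioo_subset_Icc_self (hAI s hs)) (Ioo_subset_Icc_self (hAI t ht)) hst
    have h4 : ∑ a ∈ hT'.toFinset, D' (K.map e a) ≤ ∑ a ∈ A, D' (K.map e a) :=
      Finset.sum_le_sum_of_subset_of_nonneg Finset.subset_union_left fun a _ _ => he' _
    have h5 : ∑ a ∈ A, D' (K.map e a) =
        ∑ a ∈ A, D (K.map e a) + ∑ a ∈ A, ordAt g (K.map e a) := by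
      rw [← Finset.sum_add_distrib]
      exact Finset.sum_congr rfl fun a _ => hgD _
    omega

end Bounds

/-! ### Finiteness of the combinatorial types near a divisor -/

section Types

variable {V : Set G} {D₀ D D₁ D₂ : G → ℤ}

theorem SameType.ncard_edgeSupp_eq (h : SameType V D₀ D₁ D₂) :
    (edgeSupp V D₁).ncard = (edgeSupp V D₂).ncard := by
  obtain ⟨-, ⟨k, hkV, hk, hkD⟩, -⟩ := h
  have hiff : ∀ x, k x ∉ V ↔ x ∉ V := fun x => by
    refine ⟨fun hx hxV => hx (by rwa [hkV x hxV]), fun hx => ?_⟩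
    exact connectedComponentIn_subset _ _ (hk x hx)
  have himg : edgeSupp V D₂ = k '' edgeSupp V D₁ := by
    refine Subset.antisymm (fun y hy => ?_) ?_
    · obtain ⟨x, rfl⟩ := k.surjective y
      exact ⟨x, ⟨(hiff x).1 hy.1, hkD x ▸ hy.2⟩, rfl⟩
    · rintro _ ⟨x, hx, rfl⟩
      exact ⟨(hiff x).2 hx.1, (hkD x).symm ▸ hx.2⟩
  rw [himg, ncard_image_of_injective _ k.injective]

theorem SameType.mem_linSys (h : SameType V D₀ D₁ D₂) (h₁ : D₁ ∈ LinSys D₀) :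
    D₂ ∈ LinSys D₀ := by
  obtain ⟨-, ⟨k, -, -, hkD⟩, f₁, f₂, -, hf₂, -, hf₂D, -⟩ := h
  refine ⟨(h₁.1.image k).subset fun y hy => ?_, fun y => ?_, f₂, hf₂, hf₂D⟩
  · obtain ⟨x, rfl⟩ := k.surjective y
    exact ⟨x, by rwa [mem_support, ← hkD x], rfl⟩
  · obtain ⟨x, rfl⟩ := k.surjective y
    rw [hkD]
    exact h₁.2.1 x

variable [CompactSpace G] [Nonempty G]

theorem exists_finite_types (K : EdgeAtlas V) (hD : D ∈ LinSys D₀) :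
    ∃ δ > 0, ∃ 𝒯 : Set (Set (G → ℤ)), 𝒯.Finite ∧
      (∀ D' ∈ LinSys D₀, linDist D D' < δ → ∃ A ∈ 𝒯, D' ∈ A) ∧
      ∀ A ∈ 𝒯, ∀ D₁ ∈ A, D₁ ∈ LinSys D₀ ∧ ∀ D₂ ∈ A, SameType V D₀ D₁ D₂ := by
  have hfin := K.finite_tangentDir
  have := K.finV.to_subtype
  have := K.finE
  obtain ⟨δ, hδ, N, hN⟩ := exists_type_bounds K hD.1 hD.2.1
  obtain ⟨f, hf, hfD⟩ := hD.2.2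
  have hex : ∀ D' : G → ℤ, D' ∈ LinSys D₀ → linDist D D' < δ → ∃ g : G → ℝ, IsRational g ∧
      (∀ x, D' x = D x + ordAt g x) ∧ osc g < δ := fun D' hD' hd =>
    exists_of_linDist_lt (hD.2.2.symm.trans hD'.2.2) hd
  choose! g hg hgD hgo using hex
  let B : Set (G → ℤ) := {D' | D' ∈ LinSys D₀ ∧ linDist D D' < δ}
  let τ : (G → ℤ) → (V → ℤ) × (compsOf Vᶜ → List ℤ) × (∀ v : V, TangentDir (v : G) → ℤ) :=
    fun D' => (fun v => D' v, fun e => profile (K.len e) fun t => D' (K.map e t),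
      fun v ζ => tangentSlope (g D') ζ)
  have hτ : (τ '' B).Finite := by
    have h1 : {a : V → ℤ | ∀ v, a v ∈ Icc 0 N}.Finite := Set.Finite.pi' fun _ => finite_Icc _ _
    have h2 : {a : compsOf Vᶜ → List ℤ | ∀ e, a e ∈ {l : List ℤ | (∀ x ∈ l, 1 ≤ x) ∧
        l.sum ≤ 3 * N}}.Finite := Set.Finite.pi' fun _ => finite_setOf_list_sum_le _
    have h3 : {a : ∀ v : V, TangentDir (v : G) → ℤ | ∀ v : V, a v ∈ {b : TangentDir (v : G) → ℤ |
        ∀ ζ, b ζ ∈ Icc (-N) 0}}.Finite :=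
      Set.Finite.pi' fun _ => Set.Finite.pi' fun _ => finite_Icc _ _
    refine (h1.prod (h2.prod h3)).subset ?_
    rintro _ ⟨D', hD', rfl⟩
    have h := hN (g D') D' (hg D' hD'.1 hD'.2) hD'.1.1 hD'.1.2.1 (hgD D' hD'.1 hD'.2)
      (hgo D' hD'.1 hD'.2)
    exact ⟨fun v => (h.1 v v.2).1, fun e => ⟨fun x hx => profile_mem
      (K.finite_Ioo_inter_support hD'.1.1 e) (fun t => hD'.1.2.1 _) hx, h.2 e⟩,
      fun v ζ => (h.1 v v.2).2 ζ⟩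
  refine ⟨δ, hδ, (fun w => B ∩ τ ⁻¹' {w}) '' (τ '' B), hτ.image _, fun D' hD' hd =>
    ⟨_, mem_image_of_mem _ (mem_image_of_mem τ ⟨hD', hd⟩), ⟨hD', hd⟩, rfl⟩, ?_⟩
  rintro _ ⟨w, -, rfl⟩ D₁ ⟨h₁, rfl⟩
  refine ⟨h₁.1, ?_⟩
  rintro D₂ ⟨h₂, heq⟩
  have hV : ∀ v ∈ V, D₁ v = D₂ v := fun v hv =>
    (congrFun (congrArg Prod.fst heq) ⟨v, hv⟩).symm
  refine ⟨hV, K.exists_homeomorph_of_profile_eq h₁.1.1 h₂.1.1 hV fun e =>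
    (congrFun (congrArg (fun a => a.2.1) heq) e).symm, _, _, hf.add (hg D₁ h₁.1 h₁.2),
    hf.add (hg D₂ h₂.1 h₂.2), fun x => ?_, fun x => ?_, fun v hv ζ => ?_⟩
  · rw [ordAt_add hf (hg D₁ h₁.1 h₁.2), hgD D₁ h₁.1 h₁.2, hfD, add_assoc]
  · rw [ordAt_add hf (hg D₂ h₂.1 h₂.2), hgD D₂ h₂.1 h₂.2, hfD, add_assoc]
  · rw [IsRational.tangentSlope_add hf (hg D₁ h₁.1 h₁.2),
      IsRational.tangentSlope_add hf (hg D₂ h₂.1 h₂.2)]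
    exact congrArg (tangentSlope f ζ + ·)
      (congrFun (congrFun (congrArg (fun a => a.2.2) heq) ⟨v, hv⟩) ζ).symm

/-- Every divisor of `|D₀|` lies in the closed cell of one whose number of edge chips is locally
maximal. -/
theorem exists_isLocalMaxChips (K : EdgeAtlas V) (hD : D ∈ LinSys D₀) :
    ∃ D' ∈ LinSys D₀, InClosedCell V D₀ D' D ∧ IsLocalMaxChips V D₀ D' := by
  have hfin := K.finite_tangentDir
  obtain ⟨δ, hδ, 𝒯, h𝒯, hcov, hsame⟩ := exists_finite_types K hD
  let 𝒜 : Set (Set (G → ℤ)) := {A ∈ 𝒯 | ∀ ε > 0, ∃ D' ∈ A, linDist D D' < ε}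
  have h𝒜 : 𝒜.Finite := h𝒯.subset fun A hA => hA.1
  have hsep : ∀ A : {A ∈ 𝒯 | A ∉ 𝒜}, ∃ ε > 0, ∀ D' ∈ A.1, ε ≤ linDist D D' := by
    rintro ⟨A, hA, hA'⟩
    by_contra! h
    exact hA' ⟨hA, h⟩
  choose η hη hηA using hsep
  have := (h𝒯.subset (sep_subset 𝒯 (· ∉ 𝒜))).to_subtype
  obtain ⟨ε₀, hε₀, hε₀η⟩ := exists_pos_le_of_finite η hη
  have hε : 0 < min ε₀ δ := lt_min hε₀ hδ
  have hacc : ∀ D' ∈ LinSys D₀, linDist D D' < min ε₀ δ → ∃ A ∈ 𝒜, D' ∈ A := by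
    intro D' hD' hd
    obtain ⟨A, hA, hDA⟩ := hcov D' hD' (hd.trans_le (min_le_right _ _))
    refine ⟨A, by_contra fun hA' => ?_, hDA⟩
    exact absurd (hd.trans_le (min_le_left _ _))
      (not_lt.2 ((hε₀η ⟨A, hA, hA'⟩).trans (hηA ⟨A, hA, hA'⟩ D' hDA)))
  choose! rep hrep hrepd using fun A (hA : A ∈ 𝒜) => hA.2 _ hε
  obtain ⟨A₀, hA₀, -⟩ := hacc D hD (by rwa [linDist_self])
  obtain ⟨A, hA, hmax⟩ := exists_max_image 𝒜 (fun A => (edgeSupp V (rep A)).ncard) h𝒜 ⟨A₀, hA₀⟩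
  obtain ⟨hAL, hAS⟩ := hsame A hA.1 _ (hrep A hA)
  refine ⟨rep A, hAL, fun ε hε' => ?_, _, sub_pos.2 (hrepd A hA), fun D' hD' hd => ?_⟩
  · obtain ⟨D'', hD'', hlt⟩ := hA.2 ε hε'
    exact ⟨D'', hAS D'' hD'', hlt⟩
  · have htri := linDist_triangle (hD.2.2.symm.trans hAL.2.2) (hAL.2.2.symm.trans hD'.2.2)
    obtain ⟨A', hA', hDA'⟩ := hacc D' hD' (by linarith)
    rw [((hsame A' hA'.1 _ hDA').2 _ (hrep A' hA')).ncard_edgeSupp_eq]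
    exact hmax A' hA'

theorem Generic.isLocalMaxChips (K : EdgeAtlas V) (hD : Generic V D₀ D) :
    IsLocalMaxChips V D₀ D := by
  obtain ⟨hDL, ε, hε, h⟩ := hD
  refine ⟨ε, hε, fun D' hD' hd => ?_⟩
  obtain ⟨δ, hδ, hle⟩ := exists_ncard_edgeSupp_le K hD'
  obtain ⟨D'', hsame, hlt⟩ := h D' hD' hd δ hδ
  rw [hsame.ncard_edgeSupp_eq]
  exact hle D'' (hsame.mem_linSys hDL) hlt

end Types

theorem rankGe.of_linEquiv [∀ x : G, Finite (TangentDir x)] {D D' : G → ℤ} {d : ℕ}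
    (h : rankGe D d) (hD : LinEquiv D D') : rankGe D' d := by
  intro E hE hEe hEd
  obtain ⟨F, hF, hFe, hFD⟩ := h E hE hEe hEd
  obtain ⟨f, hf, hfD⟩ := hD.symm
  refine ⟨F, hF, hFe, LinEquiv.trans ⟨f, hf, fun x => ?_⟩ hFD⟩
  rw [hfD]
  ring

/-- for a generic divisor `D ∈ |D₀|` the dimension of the cell `Δ_D` is at
least the rank `r(D)`; consequently, for every `D ∈ |D₀|`, the local dimension of
`|D₀|` at `D` is at least `r(D₀)` (there is a cell containing `D` of dimension at least
`r(D₀)`). -/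
theorem rank_le_dim (hG : IsMetricGraph G) (hconn : ConnectedSpace G)
    (V : Set G) (hV : IsGraphModel V) (hVl : LoopFree V)
    (D₀ : G → ℤ) (hD₀ : FinSupp D₀) (hD₀e : Effective D₀) :
    (∀ D ∈ LinSys D₀, Generic V D₀ D → ∀ d : ℕ, rankGe D d → (d : ℤ) ≤ cellDim V D) ∧
    (∀ D ∈ LinSys D₀, ∀ d : ℕ, rankGe D₀ d →
      ∃ D' ∈ LinSys D₀, InClosedCell V D₀ D' D ∧ (d : ℤ) ≤ cellDim V D') := by
  have := hG.1
  obtain ⟨x₀⟩ := hconn.toNonempty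
  have : Nonempty G := ⟨x₀⟩
  obtain ⟨v, U, -, hU⟩ := hG.2.2 x₀
  have := hU.nontrivial
  obtain ⟨K⟩ := hV.exists_edgeAtlas
  have := K.finite_tangentDir
  have := nonempty_tangentDir K
  refine ⟨fun D hD hgen d hd => (hgen.isLocalMaxChips K).le_cellDim K hD hd, fun D hD d hd => ?_⟩
  obtain ⟨D', hD', hcell, hloc⟩ := exists_isLocalMaxChips K hD
  exact ⟨D', hD', hcell, hloc.le_cellDim K hD' (hd.of_linEquiv hD'.2.2)⟩

end TropGraph
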